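/- Let r and s be nonnegative integers and let m ≥ 4 be even. Then K_v* has a factorization into r K_2*-factors and s C⃗_m-factors (i.e., HWP*(v; 2^r, m^s) has a solution) if m divides v, r + s = v − 1, s ≠ 1, (r, v) ≠ (0, 6), (m, r, v) ≠ (4, 0, 4), and one of the following holds: (1) m > 4, s ≠ 3 and m ≡ 0 (mod 4); (2) m > 4, v/m is even, s ≠ 3 and m ≡ 2 (mod 4); (3) m = 4 and v ≡ 0, 8, 16 (mod 24); (4) m = 4, v ≡ 12 (mod 24) and s ∉ {3, 5}; (5) m = 4, v ≡ 4, 20 (mod 24) and r is odd. -/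

import Mathlib

/-- A factorization of the digraph with arc set `A` (on vertex set `V`) into `k`
arc-disjoint spanning factors, where every connected component of the `i`-th factor
is a directed cycle of length `c i` (a `C⃗_{c i}`-factor; for `c i = 2` this is a
`K_2*`-factor, i.e. its components are double arcs).  The `i`-th factor is encoded by
a permutation `f i` of the vertex set, its arc set being `{(x, f i x) : x ∈ V}`;
the requirement that all components be directed `c i`-cycles says exactly that every
point of `f i` has minimal period `c i`.  The factors are pairwise arc-disjoint and
their arc sets partition `A`. -/
def IsFactorization {V : Type} (A : Set (V × V)) {k : ℕ} (c : Fin k → ℕ) : Prop :=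
  ∃ f : Fin k → Equiv.Perm V,
    (∀ (i : Fin k) (x : V), Function.minimalPeriod (⇑(f i)) x = c i) ∧
    (∀ (i j : Fin k) (x : V), f i x = f j x → i = j) ∧
    (∀ p : V × V, p ∈ A ↔ ∃ i, f i p.1 = p.2)

/-- `HWPStar v m n r s` : a solution to the directed Hamilton–Waterloo problem
`HWP*(v; m^r, n^s)`, i.e. a factorization of the complete symmetric digraph `K_v*`
(arc set: all ordered pairs of distinct vertices) into `r` `C⃗_m`-factors and
`s` `C⃗_n`-factors (with `K_2*` playing the role of `C⃗_2`). -/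
def HWPStar (v m n r s : ℕ) : Prop :=
  IsFactorization {p : Fin v × Fin v | p.1 ≠ p.2}
    (fun i : Fin (r + s) => if (i : ℕ) < r then m else n)

open Function

/-- `Packing m A d s`: there are `d` pairwise arc-disjoint permutation factors with arcs in `A`,
`s` of which are `C⃗_m`-factors while the others are `K_2*`-factors. -/
def Packing {V : Type} (m : ℕ) (A : V → V → Prop) (d s : ℕ) : Prop :=
  ∃ (R S : Type) (_ : Fintype R) (_ : Fintype S) (f : R ⊕ S → V → V),
    Fintype.card S = s ∧ Fintype.card R + Fintype.card S = d ∧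
    (∀ i x, minimalPeriod (f (Sum.inl i)) x = 2) ∧
    (∀ i x, minimalPeriod (f (Sum.inr i)) x = m) ∧
    (∀ i x, A x (f i x)) ∧ ∀ x, Injective fun i => f i x

namespace Packing

variable {V W : Type} {m d s : ℕ} {A B : V → V → Prop}

lemma mono (hAB : ∀ x y, A x y → B x y) (h : Packing m A d s) : Packing m B d s := by
  obtain ⟨R, S, _, _, f, h1, h2, h3, h4, h5, h6⟩ := h
  exact ⟨R, S, _, _, f, h1, h2, h3, h4, fun i x => hAB _ _ (h5 i x), h6⟩

lemma empty : Packing m A 0 0 :=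
  ⟨Empty, Empty, inferInstance, inferInstance, fun i => i.elim Empty.elim Empty.elim, by simp,
    by simp, fun i => i.elim, fun i => i.elim, by rintro (i | i) <;> exact i.elim,
    by rintro x (i | i) <;> exact i.elim⟩

lemma of_pred {ι : Type} [Fintype ι] (P : ι → Prop) [DecidablePred P] (f : ι → V → V)
    (hs : Fintype.card {i // P i} = s) (hd : Fintype.card ι = d)
    (h2 : ∀ i x, ¬ P i → minimalPeriod (f i) x = 2)
    (hm : ∀ i x, P i → minimalPeriod (f i) x = m)
    (hA : ∀ i x, A x (f i x)) (hf : ∀ x, Injective fun i => f i x) : Packing m A d s := by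
  refine ⟨{i // ¬ P i}, {i // P i}, inferInstance, inferInstance,
    Sum.elim (fun i => f i.1) (fun i => f i.1), hs, ?_, fun i x => h2 _ _ i.2,
    fun i x => hm _ _ i.2, ?_, ?_⟩
  · rw [Fintype.card_subtype_compl, ← hd]
    exact Nat.sub_add_cancel (Fintype.card_subtype_le P)
  · rintro (i | i) x <;> exact hA _ _
  · rintro x (i | i) (j | j) hij
    · exact congrArg Sum.inl (Subtype.ext (hf x hij))
    · exact absurd j.2 (by rw [← show i.1 = j.1 from hf x hij]; exact i.2)
    · exact absurd i.2 (by rw [show i.1 = j.1 from hf x hij]; exact j.2)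
    · exact congrArg Sum.inr (Subtype.ext (hf x hij))

lemma union {d' s' : ℕ} (hA : Packing m A d s) (hB : Packing m B d' s')
    (hAB : ∀ x y, A x y → ¬ B x y) :
    Packing m (fun x y => A x y ∨ B x y) (d + d') (s + s') := by
  obtain ⟨R, S, _, _, f, h1, h2, h3, h4, h5, h6⟩ := hA
  obtain ⟨R', S', _, _, f', h1', h2', h3', h4', h5', h6'⟩ := hB
  have key : ∀ i j x, f i x ≠ f' j x := fun i j x h =>
    hAB _ _ (h5 i x) (h ▸ h5' j x)
  refine ⟨R ⊕ R', S ⊕ S', inferInstance, inferInstance,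
    Sum.elim (Sum.elim (fun i => f (Sum.inl i)) (fun i => f' (Sum.inl i)))
      (Sum.elim (fun i => f (Sum.inr i)) (fun i => f' (Sum.inr i))), by simp [h1, h1'],
      by simp only [Fintype.card_sum]; omega, ?_, ?_, ?_, ?_⟩
  · rintro (i | i) x <;> simp [h3, h3']
  · rintro (i | i) x <;> simp [h4, h4']
  · rintro ((i | i) | (i | i)) x <;> simp [h5, h5']
  · rintro x ((i | i) | (i | i)) ((j | j) | (j | j)) hij <;>
      simp only [Sum.elim_inl, Sum.elim_inr] at hij <;>
      first
      | exact absurd hij (key _ _ _)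
      | exact absurd hij.symm (key _ _ _)
      | (have := h6 x hij; simp_all)
      | (have := h6' x hij; simp_all)

lemma iUnion (A : ℕ → V → V → Prop) (d s : ℕ → ℕ) (k : ℕ)
    (h : ∀ t < k, Packing m (A t) (d t) (s t))
    (hA : ∀ t < k, ∀ u < k, t ≠ u → ∀ x y, A t x y → ¬ A u x y) :
    Packing m (fun x y => ∃ t < k, A t x y) (∑ t ∈ Finset.range k, d t)
      (∑ t ∈ Finset.range k, s t) := by
  induction k with
  | zero => simpa using empty
  | succ k ih =>
    rw [Finset.sum_range_succ, Finset.sum_range_succ]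
    refine ((ih (fun t ht => h t (by omega)) fun t ht u hu => hA t (by omega) u (by omega)).union
      (h k (by omega)) ?_).mono ?_
    · rintro x y ⟨t, ht, hxy⟩
      exact hA t (by omega) k (by omega) (by omega) x y hxy
    · rintro x y (⟨t, ht, hxy⟩ | hxy)
      · exact ⟨t, by omega, hxy⟩
      · exact ⟨k, by omega, hxy⟩

end Packing

lemma minimalPeriod_eq_of_semiconj {V W : Type} {f : V → V} {g : W → W} {j : V → W}
    (hj : Injective j) (h : ∀ x, j (f x) = g (j x)) (x : V) :
    minimalPeriod g (j x) = minimalPeriod f x := by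
  refine minimalPeriod_eq_minimalPeriod_iff.2 fun n => ?_
  have : g^[n] (j x) = j (f^[n] x) := ((Semiconj.iterate_right (f := j) (fun x => h x) n) x).symm
  simp only [IsPeriodicPt, IsFixedPt, this, hj.eq_iff]

lemma minimalPeriod_eq_two {V : Type} {f : V → V} (h : ∀ x, f (f x) = x) (h' : ∀ x, f x ≠ x)
    (x : V) : minimalPeriod f x = 2 := by
  have hp : IsPeriodicPt f 2 x := h x
  have h1 : minimalPeriod f x ≠ 1 := fun h1 => h' x (minimalPeriod_eq_one_iff_isFixedPt.1 h1)
  have h2 := hp.minimalPeriod_le two_pos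
  have h3 := hp.minimalPeriod_pos two_pos
  omega

/-- If `f` advances a `ZMod n`-valued function by one then all its cycles have length
divisible by `n`. -/
lemma dvd_minimalPeriod {V : Type} {n : ℕ} {f : V → V} (φ : V → ZMod n)
    (hφ : ∀ x, φ (f x) = φ x + 1) (x : V) : n ∣ minimalPeriod f x := by
  have h : ∀ k x, φ (f^[k] x) = φ x + k := by
    intro k
    induction k with
    | zero => simp
    | succ k ih => intro x; rw [iterate_succ_apply', hφ, ih]; push_cast; ring
  have := h (minimalPeriod f x) x
  rw [iterate_minimalPeriod, left_eq_add] at this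
  exact (ZMod.natCast_eq_zero_iff _ _).1 this

lemma minimalPeriod_eq_card {V : Type} [Fintype V] {n : ℕ} [NeZero n] {f : V → V} (φ : V → ZMod n)
    (hφ : ∀ x, φ (f x) = φ x + 1) (hV : Fintype.card V = n) (x : V) : minimalPeriod f x = n := by
  have h : ∀ k x, φ (f^[k] x) = φ x + k := by
    intro k
    induction k with
    | zero => simp
    | succ k ih => intro x; rw [iterate_succ_apply', hφ, ih]; push_cast; ring
  have hsurj : Surjective φ := fun z => ⟨f^[(z - φ x).val] x, by rw [h]; simp⟩
  have hinj : Injective φ :=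
    ((Fintype.bijective_iff_surjective_and_card φ).2 ⟨hsurj, by rw [hV, ZMod.card]⟩).1
  refine Nat.dvd_antisymm (IsPeriodicPt.minimalPeriod_dvd (hinj ?_)) (dvd_minimalPeriod φ hφ x)
  rw [h]; simp

namespace Packing

variable {V W : Type} {m d s : ℕ} {A B : V → V → Prop}

lemma congr {A' : W → W → Prop} (e : V ≃ W) (hA : ∀ x y, A x y → A' (e x) (e y))
    (h : Packing m A d s) : Packing m A' d s := by
  obtain ⟨R, S, _, _, f, h1, h2, h3, h4, h5, h6⟩ := h
  have hp : ∀ i x, minimalPeriod (fun y => e (f i (e.symm y))) x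
      = minimalPeriod (f i) (e.symm x) := fun i x => by
    have := minimalPeriod_eq_of_semiconj (f := f i) (g := fun y => e (f i (e.symm y)))
      e.injective (by simp) (e.symm x)
    simpa using this
  refine ⟨R, S, _, _, fun i y => e (f i (e.symm y)), h1, h2, fun i x => ?_, fun i x => ?_,
    fun i x => ?_, fun x i j hij => ?_⟩
  · rw [hp, h3]
  · rw [hp, h4]
  · simpa using hA _ _ (h5 i (e.symm x))
  · exact h6 (e.symm x) (e.injective hij)

lemma complete_congr [Fintype V] [Fintype W] (hVW : Fintype.card V = Fintype.card W)
    (h : Packing m (fun x y : V => x ≠ y) d s) : Packing m (fun x y : W => x ≠ y) d s :=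
  h.congr (Fintype.equivOfCardEq hVW) fun _ _ hxy => by simpa using hxy

lemma bijective_of_minimalPeriod {f : V → V} {n : ℕ} (hn : 0 < n)
    (h : ∀ x, minimalPeriod f x = n) : Bijective f := by
  have hp : ∀ x, f^[n] x = x := fun x => h x ▸ iterate_minimalPeriod
  obtain ⟨k, rfl⟩ := Nat.exists_eq_succ_of_ne_zero hn.ne'
  exact ⟨fun x y hxy => by rw [← hp x, ← hp y, iterate_succ_apply, iterate_succ_apply, hxy],
    fun x => ⟨f^[k] x, by rw [← iterate_succ_apply' f k x, hp]⟩⟩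

/-- A packing of the complete symmetric digraph by the maximal number of factors is a solution
of the directed Hamilton–Waterloo problem. -/
lemma hwpStar [Fintype V] {v r : ℕ} (hV : Fintype.card V = v) (hm : 0 < m)
    (hrs : r + s = v - 1) (h : Packing m (fun x y : V => x ≠ y) (v - 1) s) :
    HWPStar v 2 m r s := by
  obtain ⟨R, S, _, _, f, h1, h2, h3, h4, h5, h6⟩ :=
    h.complete_congr (W := Fin v) (by simp [hV])
  have eR : Fin r ≃ R := Fintype.equivOfCardEq (by simp; omega)
  have eS : Fin s ≃ S := Fintype.equivOfCardEq (by simp [h1])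
  obtain ⟨e, he⟩ : ∃ e : Fin (r + s) ≃ R ⊕ S, ∀ i x,
      minimalPeriod (f (e i)) x = if (i : ℕ) < r then 2 else m := by
    refine ⟨finSumFinEquiv.symm.trans (eR.sumCongr eS), fun i x => ?_⟩
    refine Fin.addCases (fun i => ?_) (fun i => ?_) i <;> simp [h3, h4]
  have hb : ∀ i, Bijective (f (e i)) := fun i =>
    bijective_of_minimalPeriod (n := if (i : ℕ) < r then 2 else m) (by split <;> omega) (he i)
  refine ⟨fun i => Equiv.ofBijective _ (hb i), fun i x => he i x,
    fun i j x hij => e.injective (h6 x hij), fun p => ⟨fun hp => ?_, ?_⟩⟩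
  · have hinj : Injective fun i : Fin (r + s) =>
        (⟨f (e i) p.1, fun h => h5 (e i) p.1 h.symm⟩ : {y // y ≠ p.1}) :=
      fun i j hij => e.injective (h6 p.1 (Subtype.ext_iff.1 hij))
    have hbij := (Fintype.bijective_iff_injective_and_card _).2
      ⟨hinj, by rw [Fintype.card_fin, hrs, Fintype.card_subtype_compl]; simp⟩
    obtain ⟨i, hi⟩ := hbij.2 ⟨p.2, fun h => hp h.symm⟩
    exact ⟨i, Subtype.ext_iff.1 hi⟩
  · rintro ⟨i, hi⟩
    change p.1 ≠ p.2
    rw [← hi]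
    exact h5 _ _

end Packing

/-- The vertex of the block of `x` lying on the side `b`. -/
def blockPoint {X : Type} (side : X → Bool) (F : X → X) (x : X) (b : Bool) : X :=
  if b = side x then x else F x

lemma exists_side {X : Type} [Finite X] {F : X → X} (hF : ∀ x, F (F x) = x)
    (hF' : ∀ x, F x ≠ x) : ∃ side : X → Bool, ∀ x, side (F x) = !side x := by
  obtain ⟨n, ⟨e⟩⟩ := Finite.exists_equiv_fin X
  refine ⟨fun x => decide (e x < e (F x)), fun x => ?_⟩
  have : e (F x) ≠ e x := fun h => hF' x (e.injective h)
  change decide (e (F x) < e (F (F x))) = !decide (e x < e (F x))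
  rw [hF]
  by_cases h : e x < e (F x)
  · simp [h, h.le]
  · simpa [h] using lt_of_le_of_ne (not_lt.1 h) this

namespace Packing

variable {X H : Type} {m d s : ℕ}

/-- A packing of a block structure on `Bool × H` is copied to all the blocks
`{x, F x} × H` at once. -/
lemma lift [Finite X] {F : X → X} (hF : ∀ x, F (F x) = x) (hF' : ∀ x, F x ≠ x)
    {B : Bool × H → Bool × H → Prop} {A : X × H → X × H → Prop}
    (hA₁ : ∀ x b h k, B (b, h) (b, k) → A (x, h) (x, k))
    (hA₂ : ∀ x b h k, B (b, h) (!b, k) → A (x, h) (F x, k))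
    (hB : Packing m B d s) : Packing m A d s := by
  obtain ⟨side, hside⟩ := exists_side hF hF'
  obtain ⟨R, S, _, _, f, h1, h2, h3, h4, h5, h6⟩ := hB
  set bp := blockPoint side F with hbp
  have bp_side : ∀ x b, side (bp x b) = b := by
    intro x b
    simp only [hbp, blockPoint]
    split_ifs with h
    · exact h.symm
    · rw [hside]; revert h; cases b <;> cases side x <;> simp
  have bp_self : ∀ x, bp x (side x) = x := fun x => by simp [hbp, blockPoint]
  have bp_bp : ∀ x b c, bp (bp x b) c = bp x c := by
    intro x b c
    have hs := bp_side x b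
    have hs' : bp x b = x ∧ b = side x ∨ bp x b = F x ∧ b = !side x := by
      simp only [hbp, blockPoint]
      split_ifs with h
      · exact Or.inl ⟨rfl, h⟩
      · exact Or.inr ⟨rfl, by revert h; cases b <;> cases side x <;> simp⟩
    rcases hs' with ⟨h, hb⟩ | ⟨h, hb⟩
    · rw [h]
    · rw [h]
      simp only [hbp, blockPoint, hside, hF]
      cases c <;> cases side x <;> simp
  have hp : ∀ i x, minimalPeriod (fun p : X × H =>
      (bp p.1 (f i (side p.1, p.2)).1, (f i (side p.1, p.2)).2)) x
        = minimalPeriod (f i) (side x.1, x.2) := by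
    rintro i ⟨x, h⟩
    have := minimalPeriod_eq_of_semiconj (f := f i) (g := fun p : X × H =>
      (bp p.1 (f i (side p.1, p.2)).1, (f i (side p.1, p.2)).2))
      (j := fun q : Bool × H => (bp x q.1, q.2)) ?_ ?_ (side x, h)
    · simpa [bp_self] using this
    · rintro ⟨b, h⟩ ⟨c, k⟩ hq
      simp only [Prod.mk.injEq] at hq
      have := congrArg side hq.1
      rw [bp_side, bp_side] at this
      rw [this, hq.2]
    · rintro ⟨b, h⟩
      simp [bp_side, bp_bp]
  refine ⟨R, S, _, _, fun i p => (bp p.1 (f i (side p.1, p.2)).1, (f i (side p.1, p.2)).2),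
    h1, h2, fun i x => ?_, fun i x => ?_, fun i => ?_, ?_⟩
  · rw [hp, h3]
  · rw [hp, h4]
  · rintro ⟨x, h⟩
    have := h5 i (side x, h)
    obtain ⟨⟨b, k⟩, hbk⟩ : ∃ q, q = f i (side x, h) := ⟨_, rfl⟩
    simp only [← hbk] at this ⊢
    by_cases hb : b = side x
    · subst hb
      rw [bp_self]
      exact hA₁ _ _ _ _ this
    · obtain rfl : b = !side x := by revert hb; cases b <;> cases side x <;> simp
      have : bp x (!side x) = F x := by simp [hbp, blockPoint]
      rw [this]
      exact hA₂ _ _ _ _ (by assumption)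
  · rintro ⟨x, h⟩ i j hij
    simp only [Prod.mk.injEq] at hij
    refine h6 (side x, h) (Prod.ext ?_ hij.2)
    have := congrArg side hij.1
    rwa [bp_side, bp_side] at this

/-- A one-factorization of the complete graph on `X`, together with packings of `K_{2h}*` and
`K_{h,h}*`, gives a packing of the complete symmetric digraph on `X × H`. -/
lemma blowUp [Finite X] {k : ℕ} (F : ℕ → X → X) (hF : ∀ t ≤ k, ∀ x, F t (F t x) = x)
    (hF' : ∀ t ≤ k, ∀ x, F t x ≠ x) (hF'' : ∀ t ≤ k, ∀ u ≤ k, ∀ x, F t x = F u x → t = u)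
    {d' : ℕ} (c : ℕ → ℕ)
    (hB : Packing m (fun p q : Bool × H => p ≠ q) d s)
    (hC : ∀ t < k, Packing m (fun p q : Bool × H => p.1 ≠ q.1) d' (c t)) :
    Packing m (fun p q : X × H => p ≠ q) (d + k * d') (s + ∑ t ∈ Finset.range k, c t) := by
  have h0 : Packing m (fun p q : X × H => p ≠ q ∧ (q.1 = p.1 ∨ q.1 = F k p.1)) d s := by
    refine lift (hF k le_rfl) (hF' k le_rfl) ?_ ?_ hB
    · intro x b h k hne
      simpa using hne
    · intro x b h k' hne
      simpa using fun h => absurd h.symm (hF' k le_rfl x)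
  have h1 : ∀ t < k, Packing m (fun p q : X × H => q.1 = F t p.1) d' (c t) := by
    intro t ht
    refine lift (hF t ht.le) (hF' t ht.le) ?_ ?_ (hC t ht)
    · intro x b h k hne
      simp at hne
    · simp
  have := h0.union (iUnion (fun t (p q : X × H) => q.1 = F t p.1) (fun _ => d') c k h1 ?_) ?_
  · rw [Finset.sum_const, Finset.card_range, smul_eq_mul] at this
    refine this.mono ?_
    rintro p q (h | ⟨t, ht, h⟩)
    · exact h.1
    · rintro rfl
      exact hF' t ht.le _ h.symm
  · intro t ht u hu htu p q hp hq
    exact htu (hF'' t ht.le u hu.le _ (hp.symm.trans hq))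
  · rintro p q ⟨h, h' | h'⟩ ⟨t, ht, h''⟩
    · exact hF' t ht.le _ (h''.symm.trans h')
    · exact ht.ne (hF'' t ht.le k le_rfl _ (h''.symm.trans h'))

end Packing

namespace Packing

/-- A factor of `K_{h,h}*`, given by the translations `p` and `-q`, is a `C⃗_m`-factor as soon as
`q - p` has order `m / 2`. -/
lemma minimalPeriod_bipartite {G : Type} [AddCommGroup G] (p q : G) {k : ℕ}
    (hk : addOrderOf (q - p) = k) (x : Bool × G) :
    minimalPeriod (fun x : Bool × G => (!x.1, if x.1 then x.2 - q else x.2 + p)) x = 2 * k := by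
  set f := fun x : Bool × G => (!x.1, if x.1 then x.2 - q else x.2 + p) with hf
  have hf2 : ∀ x, f (f x) = (x.1, x.2 + (p - q)) := by
    rintro ⟨b, g⟩
    cases b <;> simp [hf] <;> abel
  have hit : ∀ n x, f^[2 * n] x = (x.1, x.2 + n • (p - q)) := by
    intro n
    induction n with
    | zero => simp
    | succ n ih =>
      intro x
      rw [show 2 * (n + 1) = 2 * n + 1 + 1 by ring, iterate_succ_apply, iterate_succ_apply, hf2, ih,
        succ_nsmul']
      simp [add_assoc]
  have hodd : ∀ n x, f^[2 * n + 1] x ≠ x := by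
    rintro n ⟨b, g⟩ h
    rw [iterate_succ_apply', hit] at h
    have := congrArg Prod.fst h
    simp [hf] at this
  have hk' : addOrderOf (p - q) = k := by rw [← hk, ← addOrderOf_neg, neg_sub]
  refine Nat.dvd_antisymm (IsPeriodicPt.minimalPeriod_dvd ?_) ?_
  · change f^[2 * k] x = x
    rw [hit, ← hk', addOrderOf_nsmul_eq_zero, add_zero]
  · have h := iterate_minimalPeriod (f := f) (x := x)
    rcases Nat.even_or_odd' (minimalPeriod f x) with ⟨n, hn | hn⟩
    · rw [hn, hit] at h
      rw [hn, ← hk']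
      refine mul_dvd_mul_left 2 (addOrderOf_dvd_of_nsmul_eq_zero ?_)
      simpa using congrArg Prod.snd h
    · rw [hn] at h
      exact absurd h (hodd n x)

/-- Packings of `K_{h,h}*` from permutations `σ` of `ZMod h`. -/
lemma bipartite_of_perm {h : ℕ} [NeZero h] {m s : ℕ} (σ : ZMod h → ZMod h) (hσ : Injective σ)
    (hs : Fintype.card {p // σ p ≠ p} = s)
    (hm : ∀ p, σ p ≠ p → 2 * addOrderOf (σ p - p) = m) :
    Packing m (fun p q : Bool × ZMod h => p.1 ≠ q.1) h s := by
  refine of_pred (fun p => σ p ≠ p)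
    (fun p x => (!x.1, if x.1 then x.2 - σ p else x.2 + p)) hs (ZMod.card h) ?_ ?_ ?_ ?_
  · intro p x hp
    rw [minimalPeriod_bipartite p (σ p) (k := 1)]
    rw [AddMonoid.addOrderOf_eq_one_iff, sub_eq_zero]
    exact not_not.1 hp
  · intro p x hp
    rw [minimalPeriod_bipartite p (σ p) rfl, hm p hp]
  · rintro p ⟨b, g⟩
    simp
  · rintro ⟨b, g⟩ p q hpq
    cases b
    · simpa using hpq
    · exact hσ (by simpa using hpq)

/-- The permutation of the naturals below `h` moving exactly the numbers below `s`, by adjacent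
transpositions and at most one `3`-cycle. -/
def shuffle (s p : ℕ) : ℕ :=
  if s ≤ p then p
  else if s % 2 = 0 then (if p % 2 = 0 then p + 1 else p - 1)
  else if p = 0 then 1 else if p = 1 then 2 else if p = 2 then 0
  else if p % 2 = 1 then p + 1 else p - 1

lemma bipartite {h s : ℕ} [NeZero h] (hs : s ≤ h) (hs1 : s ≠ 1) (hodd : Odd s → Odd h) :
    Packing (2 * h) (fun p q : Bool × ZMod h => p.1 ≠ q.1) h s := by
  have hlt : ∀ p < h, shuffle s p < h := by
    intro p hp; unfold shuffle; split_ifs <;> omega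
  have hinj : ∀ p < h, ∀ q < h, shuffle s p = shuffle s q → p = q := by
    intro p hp q hq hpq; unfold shuffle at hpq; split_ifs at hpq <;> omega
  have hfix : ∀ p, shuffle s p ≠ p ↔ p < s := by
    intro p; unfold shuffle; split_ifs <;> omega
  have hval : ∀ p : ZMod h, ((shuffle s p.val : ℕ) : ZMod h) = p ↔ shuffle s p.val = p.val := by
    intro p
    constructor
    · intro hp
      have := congrArg ZMod.val hp
      rwa [ZMod.val_natCast_of_lt (hlt _ p.val_lt)] at this
    · intro hp
      rw [hp, ZMod.natCast_zmod_val]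
  have hord : addOrderOf (1 : ZMod h) = h := ZMod.addOrderOf_one h
  refine bipartite_of_perm (fun p => ((shuffle s p.val : ℕ) : ZMod h)) ?_ ?_ ?_
  · intro p q hpq
    have := congrArg ZMod.val hpq
    simp only [ZMod.val_natCast_of_lt (hlt _ (ZMod.val_lt _))] at this
    exact ZMod.val_injective h (hinj _ p.val_lt _ q.val_lt this)
  · rw [Fintype.card_subtype]
    simp only [ne_eq, hval]
    simp only [hfix]
    rw [← Finset.card_range s]
    refine Finset.card_bij (fun p _ => p.val) (by simp)
      (fun p _ q _ hpq => ZMod.val_injective h hpq)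
      fun n hn => ⟨n, ?_, ?_⟩
    · simp only [Finset.mem_range] at hn
      simpa [ZMod.val_natCast_of_lt (hn.trans_le hs)] using hn
    · simp only [Finset.mem_range] at hn
      rw [ZMod.val_natCast_of_lt (hn.trans_le hs)]
  · intro p hp
    rw [ne_eq, hval, ← ne_eq, hfix] at hp
    have hcases : shuffle s p.val = p.val + 1 ∨ shuffle s p.val + 1 = p.val ∨
        (shuffle s p.val + 2 = p.val ∧ Odd s) := by
      rw [Nat.odd_iff]
      unfold shuffle; split_ifs <;> omega
    congr 1
    have hpv : ((p.val : ℕ) : ZMod h) = p := ZMod.natCast_zmod_val p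
    rcases hcases with hc | hc | ⟨hc, hso⟩
    · have : ((shuffle s p.val : ℕ) : ZMod h) - p = 1 := by rw [hc]; push_cast; rw [hpv]; ring
      rw [this, hord]
    · have : ((shuffle s p.val : ℕ) : ZMod h) - p = -1 := by
        have := congrArg (Nat.cast (R := ZMod h)) hc
        push_cast at this
        rw [hpv] at this
        linear_combination this
      rw [this, addOrderOf_neg, hord]
    · have : ((shuffle s p.val : ℕ) : ZMod h) - p = -((2 : ℕ) • 1) := by
        have := congrArg (Nat.cast (R := ZMod h)) hc
        push_cast at this
        rw [hpv] at this
        simp only [nsmul_eq_mul, Nat.cast_ofNat, mul_one]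
        linear_combination this
      rw [this, addOrderOf_neg, addOrderOf_nsmul' _ two_ne_zero, hord]
      rw [Nat.Coprime.gcd_eq_one (hodd hso).coprime_two_right, Nat.div_one]

end Packing

/-- The pairs of points of `ZMod N ∪ {∞}` with sum `t`, where `∞` replaces the second copy of `a`
in the sum `a + a`. -/
def SumRel {N : ℕ} (t : ZMod N) : Option (ZMod N) → Option (ZMod N) → Prop
  | some a, some b => a ≠ b ∧ a + b = t
  | some a, none => a + a = t
  | none, some a => a + a = t
  | none, none => False

namespace SumRel

variable {N : ℕ} {t u : ZMod N} {x y : Option (ZMod N)}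

lemma ne (h : SumRel t x y) : x ≠ y := by
  rintro rfl
  rcases x with _ | a
  · exact h
  · exact h.1 rfl

lemma symm (h : SumRel t x y) : SumRel t y x := by
  rcases x with _ | a <;> rcases y with _ | b
  · exact h
  · exact h
  · exact h
  · exact ⟨h.1.symm, by rw [add_comm, h.2]⟩

lemma unique (h : SumRel t x y) (h' : SumRel u x y) : t = u := by
  rcases x with _ | a <;> rcases y with _ | b
  · exact h.elim
  · exact (show b + b = t from h).symm.trans h'
  · exact (show a + a = t from h).symm.trans h'
  · exact h.2.symm.trans h'.2

lemma translate (i : ZMod N) (h : SumRel t x y) :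
    SumRel (2 * i + t) (x.map (· + i)) (y.map (· + i)) := by
  rcases x with _ | a <;> rcases y with _ | b
  · exact h.elim
  · have : b + b = t := h
    change b + i + (b + i) = _
    rw [← this]; ring
  · have : a + a = t := h
    change a + i + (a + i) = _
    rw [← this]; ring
  · obtain ⟨h1, h2⟩ := h
    exact ⟨fun h => h1 (add_right_cancel h), by rw [← h2]; ring⟩

end SumRel

/-- The involution pairing the points with sum `t`, for odd `N = 2 * g + 1`. -/
def pairing {N : ℕ} (g : ℕ) (t : ZMod N) : Option (ZMod N) → Option (ZMod N)
  | none => some (t * (g + 1))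
  | some a => if a + a = t then none else some (t - a)

section pairing

variable {N g : ℕ} (hN : N = 2 * g + 1) (t : ZMod N)
include hN

lemma sumRel_pairing (x : Option (ZMod N)) : SumRel t x (pairing g t x) := by
  have h : (2 * g + 1 : ZMod N) = 0 := by
    have := ZMod.natCast_self N
    rw [hN] at this ⊢
    push_cast at this
    exact this
  rcases x with _ | a
  · change t * (g + 1) + t * (g + 1) = t
    linear_combination t * h
  · by_cases ha : a + a = t
    · simp [pairing, ha, SumRel]
    · simp only [pairing, ha, if_false]
      exact ⟨fun h => ha (by linear_combination h), by ring⟩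

lemma pairing_pairing (x : Option (ZMod N)) : pairing g t (pairing g t x) = x := by
  have h : (2 * g + 1 : ZMod N) = 0 := by
    have := ZMod.natCast_self N
    rw [hN] at this ⊢
    push_cast at this
    exact this
  rcases x with _ | a
  · have : t * (g + 1 : ZMod N) + t * (g + 1) = t := by linear_combination t * h
    simp [pairing, this]
  · by_cases ha : a + a = t
    · simp only [pairing, ha, if_true]
      congr 1
      rw [← ha]
      linear_combination a * h
    · simp only [pairing, ha, if_false]
      rw [if_neg fun h => ha (by linear_combination -h)]
      simp

end pairing

/-- The cyclic successor on `Fin n`. -/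
def up {n : ℕ} (j : Fin n) : Fin n :=
  if h : j.1 + 1 < n then ⟨j.1 + 1, h⟩ else ⟨0, by have := j.2; omega⟩

/-- The cyclic predecessor on `Fin n`. -/
def down {n : ℕ} (j : Fin n) : Fin n :=
  if j.1 = 0 then ⟨n - 1, by have := j.2; omega⟩ else ⟨j.1 - 1, by have := j.2; omega⟩

lemma up_val {n : ℕ} (j : Fin n) : (up j).1 = if j.1 + 1 < n then j.1 + 1 else 0 := by
  unfold up; split_ifs <;> rfl

lemma down_val {n : ℕ} (j : Fin n) : (down j).1 = if j.1 = 0 then n - 1 else j.1 - 1 := by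
  unfold down; split_ifs <;> rfl

lemma up_down {n : ℕ} (j : Fin n) : up (down j) = j := by
  have := j.2
  ext
  have h := down_val j
  have h' := up_val (down j)
  split_ifs at h h' <;> omega

lemma down_up {n : ℕ} (j : Fin n) : down (up j) = j := by
  have := j.2
  ext
  have h := up_val j
  have h' := down_val (up j)
  split_ifs at h h' <;> omega

/-- Adjacency in the cycle on `Fin n`. -/
def CycAdj {n : ℕ} (x y : Fin n) : Prop := y = up x ∨ y = down x

/-- The Walecki zigzag through `ZMod N ∪ {∞}`. -/
def zigzag (N : ℕ) (p : Fin (N + 1)) : Option (ZMod N) :=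
  if p.1 = 0 then none
  else if p.1 % 2 = 0 then some ((p.1 / 2 : ℕ) : ZMod N) else some (-((p.1 / 2 : ℕ) : ZMod N))

lemma zigzag_injective (N : ℕ) : Injective (zigzag N) := by
  have key : ∀ i j : ℕ, i < N → j < N → ((i : ℕ) : ZMod N) = j → i = j := fun i j hi hj h => by
    have := congrArg ZMod.val h
    rwa [ZMod.val_natCast_of_lt hi, ZMod.val_natCast_of_lt hj] at this
  have key' : ∀ i j : ℕ, 0 < i + j → i + j < N → ((i : ℕ) : ZMod N) ≠ -j := fun i j h0 h1 h => by
    have : ((i + j : ℕ) : ZMod N) = 0 := by push_cast; rw [h]; ring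
    have := Nat.le_of_dvd h0 ((ZMod.natCast_eq_zero_iff _ _).1 this)
    omega
  intro p q h
  have hp := p.2
  have hq := q.2
  unfold zigzag at h
  ext
  split_ifs at h with h1 h2 h3 h4 h5 h6 h7
  · omega
  · have := key _ _ (by omega) (by omega) (Option.some.inj h)
    omega
  · exact absurd (Option.some.inj h) (key' _ _ (by omega) (by omega))
  · exact absurd (Option.some.inj h).symm (key' _ _ (by omega) (by omega))
  · have := key _ _ (by omega) (by omega) (neg_injective (Option.some.inj h))
    omega

lemma zigzag_zero {N : ℕ} {p : Fin (N + 1)} (h : p.1 = 0) : zigzag N p = none := by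
  simp [zigzag, h]

lemma zigzag_even {N k : ℕ} {p : Fin (N + 1)} (hk : 0 < k) (h : p.1 = 2 * k) :
    zigzag N p = some (k : ZMod N) := by
  simp [zigzag, h, hk.ne']

lemma zigzag_odd {N k : ℕ} {p : Fin (N + 1)} (h : p.1 = 2 * k + 1) :
    zigzag N p = some (-(k : ZMod N)) := by
  simp [zigzag, h, show (2 * k + 1) / 2 = k by omega]

lemma sumRel_zigzag_up {N : ℕ} (hN : 2 ≤ N) (p : Fin (N + 1)) :
    SumRel 0 (zigzag N p) (zigzag N (up p)) ∨ SumRel 1 (zigzag N p) (zigzag N (up p)) := by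
  have hp := p.2
  have hu := up_val p
  have hne : zigzag N p ≠ zigzag N (up p) := fun h => by
    have := congrArg Fin.val (zigzag_injective N h)
    split_ifs at hu <;> omega
  have hNN : ((N : ℕ) : ZMod N) = 0 := ZMod.natCast_self N
  obtain ⟨k, hk | hk⟩ := Nat.even_or_odd' p.1
  · left
    rcases Nat.eq_zero_or_pos k with rfl | hk0
    · rw [if_pos (by omega)] at hu
      rw [zigzag_zero (by omega), zigzag_odd (k := 0) (by omega)]
      simp [SumRel]
    · by_cases hlast : p.1 + 1 < N + 1
      · rw [if_pos hlast] at hu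
        rw [zigzag_even hk0 hk, zigzag_odd (k := k) (by omega)] at hne ⊢
        exact ⟨fun h => hne (congrArg some h), by ring⟩
      · rw [if_neg hlast] at hu
        rw [zigzag_even hk0 hk, zigzag_zero hu]
        change (k : ZMod N) + k = 0
        rw [show N = 2 * k by omega] at hNN ⊢
        push_cast at hNN ⊢
        linear_combination hNN
  · right
    by_cases hlast : p.1 + 1 < N + 1
    · rw [if_pos hlast] at hu
      rw [zigzag_odd hk, zigzag_even (k := k + 1) (by omega) (by omega)] at hne ⊢
      exact ⟨fun h => hne (congrArg some h), by push_cast; ring⟩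
    · rw [if_neg hlast] at hu
      rw [zigzag_odd hk, zigzag_zero hu]
      change -(k : ZMod N) + -k = 1
      rw [show N = 2 * k + 1 by omega] at hNN ⊢
      push_cast at hNN ⊢
      linear_combination -hNN

lemma sumRel_zigzag {N : ℕ} (hN : 2 ≤ N) {p q : Fin (N + 1)} (h : CycAdj p q) :
    SumRel 0 (zigzag N p) (zigzag N q) ∨ SumRel 1 (zigzag N p) (zigzag N q) := by
  rcases h with rfl | rfl
  · exact sumRel_zigzag_up hN p
  · have := sumRel_zigzag_up hN (down p)
    rw [up_down] at this
    exact this.imp SumRel.symm SumRel.symm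

/-- The `i`-th Hamiltonian cycle of the Walecki decomposition. -/
noncomputable def walecki (N : ℕ) [NeZero N] (i : ZMod N) : Fin (N + 1) ≃ Option (ZMod N) :=
  (Equiv.ofBijective (zigzag N) ((Fintype.bijective_iff_injective_and_card _).2
    ⟨zigzag_injective N, by simp [ZMod.card]⟩)).trans (Equiv.optionCongr (Equiv.addRight i))

lemma sumRel_walecki {N : ℕ} [NeZero N] (hN : 2 ≤ N) (i : ZMod N) {p q : Fin (N + 1)}
    (h : CycAdj p q) : SumRel (2 * i) (walecki N i p) (walecki N i q) ∨
      SumRel (2 * i + 1) (walecki N i p) (walecki N i q) := by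
  rcases sumRel_zigzag hN h with h | h
  · left; simpa [walecki] using h.translate i
  · right; exact h.translate i

lemma natCast_injOn {N a b : ℕ} (ha : a < N) (hb : b < N) (h : (a : ZMod N) = b) : a = b := by
  have := congrArg ZMod.val h
  rwa [ZMod.val_natCast_of_lt ha, ZMod.val_natCast_of_lt hb] at this

lemma SumRel.unique_natCast {N a b : ℕ} {x y : Option (ZMod N)} (ha : a < N) (hb : b < N)
    (h : SumRel (a : ZMod N) x y) (h' : SumRel (b : ZMod N) x y) : a = b :=
  natCast_injOn ha hb (h.unique h')

lemma up_cast {n : ℕ} (j : Fin n) : (((up j).1 : ℕ) : ZMod n) = j.1 + 1 := by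
  have hj := j.2
  rw [up_val]
  split_ifs with h
  · push_cast; rfl
  · have : ((j.1 + 1 : ℕ) : ZMod n) = (n : ℕ) := congrArg _ (by omega)
    rw [ZMod.natCast_self] at this
    push_cast at this ⊢
    exact this.symm

lemma up_ne_down {n : ℕ} (hn : 3 ≤ n) (j : Fin n) : up j ≠ down j := fun h => by
  have := congrArg Fin.val h
  rw [up_val, down_val] at this
  split_ifs at this <;> omega

lemma sum_range_ite_lt (e c g : ℕ) :
    ∑ i ∈ Finset.range g, (if i < e then c else 0) = c * min e g := by
  induction g with
  | zero => simp
  | succ g ih =>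
    rw [Finset.sum_range_succ, ih]
    split_ifs with h
    · rw [min_eq_right h.le, min_eq_right (show g + 1 ≤ e from h)]; ring
    · rw [min_eq_left (by omega), min_eq_left (by omega)]; rfl

namespace Packing

lemma cycAdj {w : ℕ} (hw : 3 ≤ w) : Packing w (CycAdj (n := w)) 2 2 := by
  have : NeZero w := ⟨by omega⟩
  refine of_pred (ι := Bool) (fun _ => True) (fun b => if b then up else down) (by simp) (by simp)
    (by simp) ?_ ?_ ?_
  · rintro (_ | _) x _
    · refine minimalPeriod_eq_card (fun x : Fin w => -((x.1 : ℕ) : ZMod w)) (fun x => ?_)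
        (Fintype.card_fin w) x
      have := up_cast (down x)
      rw [up_down] at this
      simp [this]
    · refine minimalPeriod_eq_card (fun x : Fin w => ((x.1 : ℕ) : ZMod w)) (fun x => ?_)
        (Fintype.card_fin w) x
      simpa using up_cast x
  · rintro (_ | _) x
    · exact Or.inr rfl
    · exact Or.inl rfl
  · rintro x (_ | _) (_ | _) h
    · rfl
    · exact absurd h.symm (up_ne_down hw x)
    · exact absurd h (up_ne_down hw x)
    · rfl

lemma sumRel {N g m : ℕ} (hN : N = 2 * g + 1) (t : ZMod N) : Packing m (SumRel t) 1 0 :=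
  of_pred (ι := Unit) (fun _ => False) (fun _ => pairing g t) (by simp) (by simp)
    (fun _ x _ => minimalPeriod_eq_two (pairing_pairing hN t)
      (fun x => (sumRel_pairing hN t x).ne.symm) x) (by simp) (fun _ => sumRel_pairing hN t)
    fun _ _ _ _ => rfl

/-- The two perfect matchings with sums `2 * i` and `2 * i + 1` carry two directed Hamiltonian
cycles, or two `K_2*`-factors. -/
lemma sumRel_two {N g : ℕ} (hN : N = 2 * g + 1) (hg : 1 ≤ g) (i : ℕ) (hi : 2 * i + 1 < N)
    (P : Prop) [Decidable P] :
    Packing (N + 1) (fun x y => SumRel ((2 * i : ℕ) : ZMod N) x y ∨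
      SumRel ((2 * i + 1 : ℕ) : ZMod N) x y) 2 (if P then 2 else 0) := by
  have : NeZero N := ⟨by omega⟩
  split_ifs
  · refine (cycAdj (w := N + 1) (by omega)).congr (walecki N i) fun x y hxy => ?_
    have := sumRel_walecki (by omega) (i : ZMod N) hxy
    push_cast
    exact this
  · exact (sumRel hN _).union (sumRel hN _) fun x y h h' => by
      have := h.unique_natCast (by omega) (by omega) h'
      omega

/-- Factorizations of `K_w*` into `K_2*`-factors and an even number of directed Hamiltonian
cycles. -/
lemma hamiltonian_even {N g e : ℕ} (hN : N = 2 * g + 1) (hg : 1 ≤ g) (he : e ≤ g) :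
    Packing (N + 1) (fun x y : Option (ZMod N) => x ≠ y) N (2 * e) := by
  have h1 := iUnion (fun i x y => SumRel ((2 * i : ℕ) : ZMod N) x y ∨
      SumRel ((2 * i + 1 : ℕ) : ZMod N) x y) (fun _ => 2) (fun i => if i < e then 2 else 0) g
    (fun i hi => sumRel_two hN hg i (by omega) (i < e)) (by
      intro t ht u hu htu x y h h'
      rcases h with h | h <;> rcases h' with h' | h' <;>
      · have := h.unique_natCast (by omega) (by omega) h'
        omega)
  have h2 := h1.union (sumRel (m := N + 1) hN ((2 * g : ℕ) : ZMod N)) (by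
      rintro x y ⟨t, ht, h⟩ h'
      rcases h with h | h <;>
      · have := h.unique_natCast (by omega) (by omega) h'
        omega)
  rw [sum_range_ite_lt, min_eq_left he] at h2
  simp only [Finset.sum_const, Finset.card_range, smul_eq_mul, add_zero] at h2
  rw [show g * 2 + 1 = N by omega] at h2
  refine h2.mono fun x y h => ?_
  rcases h with ⟨t, _, h | h⟩ | h <;> exact h.ne

/-- The complete graph on an even number of vertices, blown up. -/
lemma blowUp_complete {H : Type} {g m d d' s v v' : ℕ} [Fintype H] (hg : 1 ≤ g)
    (hH : 2 * g * Fintype.card H = v) (hv' : d + (2 * g - 2) * d' = v') (c : ℕ → ℕ)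
    (hB : Packing m (fun p q : Bool × H => p ≠ q) d s)
    (hC : ∀ t < 2 * g - 2, Packing m (fun p q : Bool × H => p.1 ≠ q.1) d' (c t)) :
    Packing m (fun p q : Fin v => p ≠ q) v' (s + ∑ t ∈ Finset.range (2 * g - 2), c t) := by
  obtain ⟨k, rfl⟩ : ∃ k, g = k + 1 := ⟨g - 1, by omega⟩
  have hN : 2 * k + 1 = 2 * k + 1 := rfl
  have := blowUp (X := Option (ZMod (2 * k + 1))) (k := 2 * (k + 1) - 2)
    (fun t => pairing k (t : ZMod (2 * k + 1))) (fun t _ => pairing_pairing hN _)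
    (fun t _ x => (sumRel_pairing hN _ x).ne.symm) (fun t ht u hu x h => by
      have h1 := sumRel_pairing hN (t : ZMod (2 * k + 1)) x
      have h2 := sumRel_pairing hN (u : ZMod (2 * k + 1)) x
      rw [← h] at h2
      exact h1.unique_natCast (by omega) (by omega) h2) c hB hC
  rw [hv'] at this
  refine this.complete_congr ?_
  rw [Fintype.card_prod, Fintype.card_option, ZMod.card, Fintype.card_fin, ← hH]
  ring

end Packing

/-- Stay, or step cyclically forwards or backwards. -/
def shift {n : ℕ} (d : Fin 3) (j : Fin n) : Fin n :=
  if d = 0 then j else if d = 1 then up j else down j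

/-- Columns of a cyclic strip are classified as the first, second, third or last column, or by
parity. -/
def colType {n : ℕ} (j : Fin n) : Fin 6 :=
  if j.1 = 0 then 0 else if j.1 + 1 = n then 5 else if j.1 = 1 then 1 else if j.1 = 2 then 2
  else if j.1 % 2 = 1 then 3 else 4

/-- What a factor does at a vertex of the strip: the direction of the arc, the row of its head, and
the coefficients `cn`, `cj`, `c0` of the position `cn * n + cj * j + c0` of the vertex in column `j`
along a directed Hamiltonian cycle. -/
structure Step (W : ℕ) where
  dir : Fin 3
  row : Fin W
  cn : ℤ
  cj : ℤ
  c0 : ℤ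

section strip

variable {n W : ℕ} (T : Fin 6 → Fin W → Step W)

/-- The permutation of the strip described by a table of steps. -/
def stripMap (x : Fin n × Fin W) : Fin n × Fin W :=
  (shift (T (colType x.1) x.2).dir x.1, (T (colType x.1) x.2).row)

/-- The position of a vertex along a directed Hamiltonian cycle. -/
def stripPos (x : Fin n × Fin W) : ℤ :=
  (T (colType x.1) x.2).cn * n + (T (colType x.1) x.2).cj * x.1.1 + (T (colType x.1) x.2).c0

/-- The arcs of a strip, given by the allowed arcs at each type of column. -/
def StripAdj (L : Fin 6 → Fin 3 → Fin W → Fin W → Prop) (x y : Fin n × Fin W) : Prop :=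
  ∃ d, y.1 = shift d x.1 ∧ L (colType x.1) d x.2 y.2

lemma shift_injective (hn : 3 ≤ n) (j : Fin n) : Injective fun d => shift d j := by
  have h1 : up j ≠ j := fun h => by
    have := congrArg Fin.val h
    rw [up_val] at this
    split_ifs at this <;> omega
  have h2 : down j ≠ j := fun h => by
    have := congrArg Fin.val h
    rw [down_val] at this
    split_ifs at this <;> omega
  have h3 := up_ne_down hn j
  intro d d' h
  fin_cases d <;> fin_cases d' <;> simp_all [shift, eq_comm]

lemma Packing.strip [NeZero (W * n)] {k s : ℕ} (hn : 3 ≤ n)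
    (L : Fin 6 → Fin 3 → Fin W → Fin W → Prop)
    (T : Fin k → Fin 6 → Fin W → Step W) (hs : s ≤ k)
    (hL : ∀ i t a, L t (T i t a).dir a (T i t a).row) (hL0 : ∀ t a, ¬ L t 0 a a)
    (hT : ∀ t a i i', (T i t a).dir = (T i' t a).dir → (T i t a).row = (T i' t a).row → i = i')
    (hH : ∀ i : Fin k, i.1 < s → ∀ x : Fin n × Fin W,
      ((W * n : ℕ) : ℤ) ∣ stripPos (T i) (stripMap (T i) x) - stripPos (T i) x - 1)
    (hK : ∀ i : Fin k, ¬ i.1 < s → ∀ x : Fin n × Fin W, stripMap (T i) (stripMap (T i) x) = x) :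
    Packing (W * n) (StripAdj (n := n) L) k s := by
  refine of_pred (fun i : Fin k => i.1 < s) (fun i => stripMap (T i)) ?_ (by simp) ?_ ?_
    (fun i x => ⟨_, rfl, hL i _ _⟩) ?_
  · rw [Fintype.card_subtype, Fin.card_filter_val_lt]
    exact min_eq_right hs
  · refine fun i x hi => minimalPeriod_eq_two (hK i hi) (fun x hx => ?_) x
    have h1 : (T i (colType x.1) x.2).dir = 0 :=
      shift_injective hn x.1 ((congrArg Prod.fst hx).trans (by simp [shift]))
    have h2 : (T i (colType x.1) x.2).row = x.2 := congrArg Prod.snd hx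
    have := hL i (colType x.1) x.2
    rw [h1, h2] at this
    exact hL0 _ _ this
  · refine fun i x hi => minimalPeriod_eq_card
      (fun x => ((stripPos (T i) x : ℤ) : ZMod (W * n))) (fun x => ?_) (by simp [mul_comm]) x
    have := (ZMod.intCast_zmod_eq_zero_iff_dvd _ _).2 (hH i hi x)
    push_cast at this
    linear_combination this
  · intro x i i' h
    exact hT _ _ i i' (shift_injective hn x.1 (congrArg Prod.fst h)) (congrArg Prod.snd h)

/-- The signed length of a step. -/
def disp (d : Fin 3) : ℤ := if d = 0 then 0 else if d = 1 then 1 else -1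

lemma shift_shift (j : Fin n) {d d' : Fin 3} (h : disp d' = -disp d) :
    shift d' (shift d j) = j := by
  fin_cases d <;> fin_cases d' <;> simp_all [shift, disp, up_down, down_up]

/-- A step between types of columns. `wrap` counts how often the step passes from the first to the
last column, and unless the step is `free` it starts in column `a * n + b`. -/
structure Transition where
  src : Fin 6
  dst : Fin 6
  dir : Fin 3
  wrap : ℤ
  free : Bool
  a : ℤ
  b : ℤ

/-- All possible transitions; `t` is the type of the penultimate column. -/
def transitions (t : Fin 6) : List Transition :=
  [⟨0, 0, 0, 0, true, 0, 0⟩, ⟨1, 1, 0, 0, true, 0, 0⟩, ⟨2, 2, 0, 0, true, 0, 0⟩,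
    ⟨3, 3, 0, 0, true, 0, 0⟩, ⟨4, 4, 0, 0, true, 0, 0⟩, ⟨5, 5, 0, 0, true, 0, 0⟩,
    ⟨0, 1, 1, 0, false, 0, 0⟩, ⟨1, 2, 1, 0, false, 0, 1⟩, ⟨2, 3, 1, 0, false, 0, 2⟩,
    ⟨3, 4, 1, 0, true, 0, 0⟩, ⟨4, 3, 1, 0, true, 0, 0⟩, ⟨t, 5, 1, 0, false, 1, -2⟩,
    ⟨5, 0, 1, -1, false, 1, -1⟩,
    ⟨1, 0, 2, 0, false, 0, 1⟩, ⟨2, 1, 2, 0, false, 0, 2⟩, ⟨3, 2, 2, 0, false, 0, 3⟩,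
    ⟨4, 3, 2, 0, true, 0, 0⟩, ⟨3, 4, 2, 0, true, 0, 0⟩, ⟨5, t, 2, 0, false, 1, -1⟩,
    ⟨0, 5, 2, 1, false, 0, 0⟩]

lemma colType_first {j : Fin n} (h : j.1 = 0) : colType j = 0 := by simp [colType, h]

lemma colType_last {j : Fin n} (h : j.1 ≠ 0) (h' : j.1 + 1 = n) : colType j = 5 := by
  simp [colType, h, h']

lemma colType_second {j : Fin n} (h : j.1 = 1) (h' : j.1 + 1 ≠ n) : colType j = 1 := by
  simp_all [colType]

lemma colType_third {j : Fin n} (h : j.1 = 2) (h' : j.1 + 1 ≠ n) : colType j = 2 := by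
  simp_all [colType]

lemma colType_middle {j : Fin n} (h : 3 ≤ j.1) (h' : j.1 + 1 ≠ n) :
    colType j = if j.1 % 2 = 1 then 3 else 4 := by
  simp [colType, h', show j.1 ≠ 0 by omega, show j.1 ≠ 1 by omega, show j.1 ≠ 2 by omega]

lemma colType_cases (j : Fin n) :
    j.1 = 0 ∧ colType j = 0 ∨ j.1 ≠ 0 ∧ j.1 + 1 = n ∧ colType j = 5 ∨
    j.1 + 1 ≠ n ∧ (j.1 = 1 ∧ colType j = 1 ∨ j.1 = 2 ∧ colType j = 2 ∨
      3 ≤ j.1 ∧ j.1 % 2 = 1 ∧ colType j = 3 ∨ 3 ≤ j.1 ∧ j.1 % 2 = 0 ∧ colType j = 4) := by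
  by_cases h0 : j.1 = 0
  · exact Or.inl ⟨h0, colType_first h0⟩
  by_cases h5 : j.1 + 1 = n
  · exact Or.inr (Or.inl ⟨h0, h5, colType_last h0 h5⟩)
  refine Or.inr (Or.inr ⟨h5, ?_⟩)
  by_cases h1 : j.1 = 1
  · exact Or.inl ⟨h1, colType_second h1 h5⟩
  by_cases h2 : j.1 = 2
  · exact Or.inr (Or.inl ⟨h2, colType_third h2 h5⟩)
  have := colType_middle (show 3 ≤ j.1 by omega) h5
  split_ifs at this with h
  · exact Or.inr (Or.inr (Or.inl ⟨by omega, h, this⟩))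
  · exact Or.inr (Or.inr (Or.inr ⟨by omega, by omega, this⟩))

set_option maxHeartbeats 1000000 in
lemma exists_transition (hn : 5 ≤ n) {t : Fin 6} (ht : t = if n % 2 = 1 then 3 else 4)
    (j : Fin n) (d : Fin 3) :
    ∃ τ ∈ transitions t, τ.src = colType j ∧ τ.dst = colType (shift d j) ∧ τ.dir = d ∧
      ((shift d j).1 : ℤ) = j.1 + disp d + τ.wrap * n ∧
      (τ.free = false → (j.1 : ℤ) = τ.a * n + τ.b) := by
  have hj := colType_cases j
  have hj' := colType_cases (shift d j)
  generalize hc : colType j = c at *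
  generalize hc' : colType (shift d j) = c' at *
  have hlt := j.2
  have hd : (shift d j).1 = j.1 ∧ d = 0 ∨
      (j.1 + 1 < n ∧ (shift d j).1 = j.1 + 1 ∨ j.1 + 1 = n ∧ (shift d j).1 = 0) ∧ d = 1 ∨
      (j.1 = 0 ∧ (shift d j).1 + 1 = n ∨ (shift d j).1 + 1 = j.1) ∧ d = 2 := by
    have hu := up_val j
    have hd := down_val j
    fin_cases d
    · exact Or.inl ⟨rfl, rfl⟩
    · refine Or.inr (Or.inl ⟨?_, rfl⟩)
      change _ ∧ (up j).1 = _ ∨ _ ∧ (up j).1 = _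
      split_ifs at hu <;> omega
    · refine Or.inr (Or.inr ⟨?_, rfl⟩)
      change _ ∧ (down j).1 + 1 = _ ∨ (down j).1 + 1 = _
      split_ifs at hd <;> omega
  generalize (shift d j).1 = q at *
  generalize j.1 = p at *
  clear hc hc'
  rcases hj with ⟨h, rfl⟩ | ⟨h, h', rfl⟩ |
    ⟨h, ⟨h', rfl⟩ | ⟨h', rfl⟩ | ⟨h', h'', rfl⟩ | ⟨h', h'', rfl⟩⟩ <;>
  rcases hj' with ⟨k, rfl⟩ | ⟨k, k', rfl⟩ |
    ⟨k, ⟨k', rfl⟩ | ⟨k', rfl⟩ | ⟨k', k'', rfl⟩ | ⟨k', k'', rfl⟩⟩ <;>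
  rcases hd with ⟨hd, rfl⟩ | ⟨⟨h0, hd⟩ | ⟨h0, hd⟩, rfl⟩ | ⟨⟨h0, hd⟩ | hd, rfl⟩ <;>
  split_ifs at ht <;> subst ht <;>
  first
  | (exfalso; omega)
  | (simp [transitions, disp]; omega)

/-- The position increases by one, modulo the size of the strip, along a transition. -/
def Transition.Advances (τ : Transition) : Prop :=
  ∀ i, (T τ.src i).dir = τ.dir →
    (W : ℤ) ∣ (T τ.dst (T τ.src i).row).cn + (T τ.dst (T τ.src i).row).cj * (τ.a + τ.wrap)
      - (T τ.src i).cn - (T τ.src i).cj * τ.a ∧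
    (T τ.dst (T τ.src i).row).cj * (τ.b + disp τ.dir) + (T τ.dst (T τ.src i).row).c0
      = (T τ.src i).cj * τ.b + (T τ.src i).c0 + 1 ∧
    (τ.free = true → (T τ.dst (T τ.src i).row).cj = (T τ.src i).cj)

instance (τ : Transition) : Decidable (τ.Advances T) := by
  unfold Transition.Advances
  infer_instance

/-- Along a transition, the next step leads back. -/
def Transition.Returns (τ : Transition) : Prop :=
  ∀ i, (T τ.src i).dir = τ.dir → (T τ.dst (T τ.src i).row).row = i ∧
    disp (T τ.dst (T τ.src i).row).dir = -disp τ.dir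

instance (τ : Transition) : Decidable (τ.Returns T) := by
  unfold Transition.Returns
  infer_instance

lemma stripPos_stripMap (hn : 5 ≤ n) {t : Fin 6} (ht : t = if n % 2 = 1 then 3 else 4)
    (h : ∀ τ ∈ transitions t, τ.Advances T) (x : Fin n × Fin W) :
    ((W * n : ℕ) : ℤ) ∣ stripPos T (stripMap T x) - stripPos T x - 1 := by
  obtain ⟨j, i⟩ := x
  obtain ⟨τ, hτ, h1, h2, h3, h4, h5⟩ := exists_transition hn ht j (T (colType j) i).dir
  obtain ⟨⟨z, hz⟩, h6, h7⟩ := h τ hτ i (by rw [h1, h3])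
  simp only [stripPos, stripMap]
  rw [← h2, h4, ← h1]
  rw [← h1] at h3
  rw [← h3]
  refine ⟨z, ?_⟩
  push_cast
  cases hf : τ.free
  · rw [h5 hf]
    linear_combination (n : ℤ) * hz + h6
  · have h7 := h7 hf
    linear_combination (n : ℤ) * hz + h6
      + (j.1 - τ.a * n - τ.b) * h7

lemma stripMap_stripMap (hn : 5 ≤ n) {t : Fin 6} (ht : t = if n % 2 = 1 then 3 else 4)
    (h : ∀ τ ∈ transitions t, τ.Returns T) (x : Fin n × Fin W) :
    stripMap T (stripMap T x) = x := by
  obtain ⟨j, i⟩ := x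
  obtain ⟨τ, hτ, h1, h2, h3, h4, h5⟩ := exists_transition hn ht j (T (colType j) i).dir
  obtain ⟨h6, h7⟩ := h τ hτ i (by rw [h1, h3])
  rw [h3, h2, h1] at h7
  rw [h1, h2] at h6
  exact Prod.ext (shift_shift _ h7) h6

end strip

/-- Seven directed Hamiltonian cycles of the ladder. -/
def ladderSeven (i : Fin 7) (t : Fin 6) : Fin 4 → Step 4 :=
  ![
    ![![⟨0, 1, 0, 0, 0⟩, ⟨0, 2, 0, 0, 1⟩, ⟨1, 3, 0, 0, 2⟩, ⟨1, 2, 0, 0, 4⟩],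
      ![⟨1, 2, 0, 0, 8⟩, ⟨1, 3, 0, 0, 6⟩, ⟨0, 1, 0, 0, 5⟩, ⟨2, 3, 0, 0, 3⟩],
      ![⟨1, 2, 0, 4, 4⟩, ⟨1, 3, 0, 4, 2⟩, ⟨0, 1, 0, 4, 1⟩, ⟨2, 0, 0, 4, -1⟩],
      ![⟨1, 0, 4, 0, -1⟩, ⟨0, 0, 4, 0, -2⟩, ⟨0, 1, 4, 0, -3⟩, ⟨2, 0, 4, 0, -5⟩]],
    ![![⟨0, 3, 0, 0, 0⟩, ⟨2, 0, 0, 0, 2⟩, ⟨1, 2, 2, 0, 0⟩, ⟨0, 1, 0, 0, 1⟩],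
      ![⟨1, 3, 2, 0, 3⟩, ⟨2, 2, 2, 0, -1⟩, ⟨0, 3, 2, 0, 1⟩, ⟨0, 0, 2, 0, 2⟩],
      ![⟨1, 3, 2, 2, 1⟩, ⟨0, 2, 2, -2, 1⟩, ⟨2, 1, 2, -2, 2⟩, ⟨0, 0, 2, 2, 0⟩],
      ![⟨0, 2, 0, 0, 3⟩, ⟨1, 0, 4, 0, -1⟩, ⟨2, 1, 0, 0, 4⟩, ⟨0, 1, 4, 0, -2⟩]],
    ![![⟨2, 0, 0, 0, 0⟩, ⟨2, 1, 0, 0, 2⟩, ⟨0, 0, 4, 0, -1⟩, ⟨1, 3, 4, 0, -3⟩],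
      ![⟨2, 3, 4, 0, -4⟩, ⟨0, 2, 4, 0, -6⟩, ⟨0, 0, 4, 0, -5⟩, ⟨2, 2, 4, 0, -2⟩],
      ![⟨0, 2, 4, -4, -1⟩, ⟨0, 0, 4, -4, -2⟩, ⟨0, 3, 4, -4, 0⟩, ⟨2, 1, 4, -4, 1⟩],
      ![⟨1, 1, 0, 0, 1⟩, ⟨0, 2, 0, 0, 3⟩, ⟨0, 3, 0, 0, 4⟩, ⟨2, 1, 0, 0, 5⟩]],
    ![![⟨2, 2, 0, 0, 0⟩, ⟨0, 3, 0, 0, 2⟩, ⟨1, 1, 0, 0, 5⟩, ⟨1, 0, 0, 0, 3⟩],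
      ![⟨2, 2, 0, 0, 4⟩, ⟨0, 3, 0, 0, 6⟩, ⟨1, 0, 0, 0, 9⟩, ⟨1, 1, 0, 0, 7⟩],
      ![⟨0, 3, 0, 4, 2⟩, ⟨2, 2, 0, 4, 0⟩, ⟨1, 0, 0, 4, 5⟩, ⟨1, 1, 0, 4, 3⟩],
      ![⟨0, 3, 4, 0, -2⟩, ⟨2, 2, 4, 0, -4⟩, ⟨1, 1, 0, 0, 1⟩, ⟨1, 0, 4, 0, -1⟩]],
    ![![⟨0, 2, 0, 0, 0⟩, ⟨2, 2, 4, 0, -2⟩, ⟨0, 3, 0, 0, 1⟩, ⟨1, 1, 0, 0, 2⟩],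
      ![⟨0, 3, 0, 0, 4⟩, ⟨0, 0, 0, 0, 3⟩, ⟨1, 1, 0, 0, 7⟩, ⟨1, 0, 0, 0, 5⟩],
      ![⟨2, 2, 0, 4, -2⟩, ⟨0, 3, 0, 4, 0⟩, ⟨1, 1, 0, 4, 3⟩, ⟨1, 0, 0, 4, 1⟩],
      ![⟨2, 2, 4, 0, -6⟩, ⟨0, 3, 4, 0, -4⟩, ⟨1, 0, 4, 0, -1⟩, ⟨1, 1, 4, 0, -3⟩]],
    ![![⟨2, 1, 0, 0, 0⟩, ⟨2, 3, 0, 0, 2⟩, ⟨1, 0, 4, 0, -4⟩, ⟨0, 0, 4, 0, -1⟩],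
      ![⟨0, 1, 4, 0, -3⟩, ⟨2, 3, 4, 0, -2⟩, ⟨2, 2, 4, 0, -5⟩, ⟨0, 2, 4, 0, -6⟩],
      ![⟨0, 1, 4, -4, 0⟩, ⟨2, 3, 4, -4, 1⟩, ⟨0, 0, 4, -4, -1⟩, ⟨0, 2, 4, -4, -2⟩],
      ![⟨2, 3, 0, 0, 5⟩, ⟨1, 1, 0, 0, 1⟩, ⟨0, 0, 0, 0, 4⟩, ⟨0, 2, 0, 0, 3⟩]],
    ![![⟨2, 3, 0, 0, 0⟩, ⟨0, 0, 4, 0, -1⟩, ⟨0, 1, 4, 0, -2⟩, ⟨0, 2, 4, 0, -3⟩],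
      ![⟨0, 2, 4, 0, -5⟩, ⟨1, 2, 4, 0, -7⟩, ⟨2, 3, 4, 0, -4⟩, ⟨0, 1, 4, 0, -8⟩],
      ![⟨2, 3, 4, -4, -1⟩, ⟨1, 2, 4, -4, -3⟩, ⟨2, 0, 4, -4, 2⟩, ⟨0, 1, 4, -4, -4⟩],
      ![⟨0, 1, 0, 0, 2⟩, ⟨2, 3, 0, 0, 3⟩, ⟨2, 0, 0, 0, 6⟩, ⟨0, 0, 0, 0, 1⟩]]]
    i (![0, 1, 2, 2, 2, 3] t)

/-- Five directed Hamiltonian cycles and two `K_2*`-factors of the ladder. -/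
def ladderFive (i : Fin 7) (t : Fin 6) : Fin 4 → Step 4 :=
  ![
    ![![⟨0, 2, 0, 0, 0⟩, ⟨0, 0, 4, 0, -1⟩, ⟨1, 1, 0, 0, 1⟩, ⟨1, 2, 0, 0, 5⟩],
      ![⟨2, 3, 0, 0, 4⟩, ⟨0, 3, 0, 0, 2⟩, ⟨1, 0, 0, 0, 6⟩, ⟨0, 0, 0, 0, 3⟩],
      ![⟨0, 3, 0, 4, -1⟩, ⟨0, 2, 0, 4, 1⟩, ⟨1, 0, 0, 4, 2⟩, ⟨0, 1, 0, 4, 0⟩],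
      ![⟨0, 1, 4, 0, -5⟩, ⟨0, 3, 4, 0, -4⟩, ⟨1, 1, 4, 0, -2⟩, ⟨0, 2, 4, 0, -3⟩]],
    ![![⟨0, 1, 0, 0, 0⟩, ⟨0, 2, 0, 0, 1⟩, ⟨1, 3, 0, 0, 2⟩, ⟨0, 0, 4, 0, -1⟩],
      ![⟨0, 1, 4, 0, -3⟩, ⟨2, 3, 4, 0, -2⟩, ⟨0, 0, 4, 0, -4⟩, ⟨1, 1, 0, 0, 3⟩],
      ![⟨2, 2, 4, -2, -1⟩, ⟨0, 3, 0, 2, 0⟩, ⟨0, 0, 4, -2, -2⟩, ⟨1, 1, 0, 2, 1⟩],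
      ![⟨2, 2, 2, 0, 1⟩, ⟨0, 2, 2, 0, -2⟩, ⟨0, 3, 2, 0, -1⟩, ⟨0, 0, 2, 0, 0⟩]],
    ![![⟨0, 3, 0, 0, 0⟩, ⟨2, 2, 0, 0, 2⟩, ⟨0, 0, 4, 0, -1⟩, ⟨0, 1, 0, 0, 1⟩],
      ![⟨0, 3, 4, 0, -3⟩, ⟨0, 0, 4, 0, -4⟩, ⟨0, 1, 4, 0, -5⟩, ⟨2, 2, 4, 0, -2⟩],
      ![⟨0, 1, 4, -4, 1⟩, ⟨2, 2, 4, -4, 2⟩, ⟨0, 3, 4, -4, -1⟩, ⟨0, 0, 4, -4, 0⟩],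
      ![⟨0, 3, 0, 0, 4⟩, ⟨2, 2, 0, 0, 6⟩, ⟨0, 0, 0, 0, 3⟩, ⟨0, 1, 0, 0, 5⟩]],
    ![![⟨2, 2, 0, 0, 0⟩, ⟨2, 3, 4, 0, -2⟩, ⟨0, 1, 4, 0, -3⟩, ⟨1, 0, 4, 0, -5⟩],
      ![⟨2, 2, 4, 0, -4⟩, ⟨0, 2, 4, 0, -7⟩, ⟨2, 3, 4, 0, -6⟩, ⟨0, 1, 4, 0, -8⟩],
      ![⟨2, 3, 4, -4, -1⟩, ⟨0, 0, 4, -4, -2⟩, ⟨0, 1, 4, -4, -3⟩, ⟨0, 2, 4, -4, -4⟩],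
      ![⟨2, 3, 0, 0, 3⟩, ⟨0, 0, 0, 0, 2⟩, ⟨0, 1, 0, 0, 1⟩, ⟨1, 0, 4, 0, -1⟩]],
    ![![⟨2, 3, 0, 0, 0⟩, ⟨0, 3, 0, 0, 2⟩, ⟨1, 0, 0, 0, 5⟩, ⟨1, 1, 0, 0, 3⟩],
      ![⟨0, 2, 0, 0, 6⟩, ⟨2, 2, 0, 0, 4⟩, ⟨1, 1, 0, 0, 7⟩, ⟨1, 0, 0, 0, 9⟩],
      ![⟨0, 2, 0, 4, 2⟩, ⟨2, 3, 0, 4, 0⟩, ⟨1, 1, 0, 4, 3⟩, ⟨1, 0, 0, 4, 5⟩],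
      ![⟨0, 2, 4, 0, -2⟩, ⟨2, 3, 4, 0, -4⟩, ⟨1, 0, 4, 0, -1⟩, ⟨1, 1, 0, 0, 1⟩]],
    ![![⟨2, 1, 0, 0, 0⟩, ⟨2, 0, 0, 0, 0⟩, ⟨1, 2, 0, 0, 0⟩, ⟨1, 3, 0, 0, 0⟩],
      ![⟨1, 3, 0, 0, 0⟩, ⟨1, 2, 0, 0, 0⟩, ⟨2, 2, 0, 0, 0⟩, ⟨2, 3, 0, 0, 0⟩],
      ![⟨1, 3, 0, 0, 0⟩, ⟨1, 2, 0, 0, 0⟩, ⟨2, 1, 0, 0, 0⟩, ⟨2, 0, 0, 0, 0⟩],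
      ![⟨1, 1, 0, 0, 0⟩, ⟨1, 0, 0, 0, 0⟩, ⟨2, 1, 0, 0, 0⟩, ⟨2, 0, 0, 0, 0⟩]],
    ![![⟨2, 0, 0, 0, 0⟩, ⟨2, 1, 0, 0, 0⟩, ⟨0, 3, 0, 0, 0⟩, ⟨0, 2, 0, 0, 0⟩],
      ![⟨1, 2, 0, 0, 0⟩, ⟨1, 3, 0, 0, 0⟩, ⟨0, 3, 0, 0, 0⟩, ⟨0, 2, 0, 0, 0⟩],
      ![⟨1, 2, 0, 0, 0⟩, ⟨1, 3, 0, 0, 0⟩, ⟨2, 0, 0, 0, 0⟩, ⟨2, 1, 0, 0, 0⟩],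
      ![⟨1, 0, 0, 0, 0⟩, ⟨1, 1, 0, 0, 0⟩, ⟨2, 0, 0, 0, 0⟩, ⟨2, 1, 0, 0, 0⟩]]]
    i (![0, 1, 2, 2, 2, 3] t)

/-- Four directed Hamiltonian cycles of a doubled even cycle. -/
def doubledEvenCycle (i : Fin 4) (t : Fin 6) : Fin 2 → Step 2 :=
  ![
    ![![⟨1, 0, 0, 1, 0⟩, ⟨1, 1, 1, 1, 0⟩], ![⟨1, 0, 0, 1, 0⟩, ⟨1, 1, 1, 1, 0⟩],
      ![⟨1, 0, 0, 1, 0⟩, ⟨1, 1, 1, 1, 0⟩], ![⟨1, 0, 0, 1, 0⟩, ⟨1, 1, 1, 1, 0⟩],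
      ![⟨1, 0, 0, 1, 0⟩, ⟨1, 1, 1, 1, 0⟩], ![⟨1, 1, 0, 1, 0⟩, ⟨1, 0, 1, 1, 0⟩]],
    ![![⟨2, 1, 0, -1, 0⟩, ⟨2, 0, -1, -1, 0⟩], ![⟨2, 0, 0, -1, 0⟩, ⟨2, 1, -1, -1, 0⟩],
      ![⟨2, 0, 0, -1, 0⟩, ⟨2, 1, -1, -1, 0⟩], ![⟨2, 0, 0, -1, 0⟩, ⟨2, 1, -1, -1, 0⟩],
      ![⟨2, 0, 0, -1, 0⟩, ⟨2, 1, -1, -1, 0⟩], ![⟨2, 0, 0, -1, 0⟩, ⟨2, 1, -1, -1, 0⟩]],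
    ![![⟨1, 1, 0, 1, 0⟩, ⟨1, 0, 1, 1, 0⟩], ![⟨1, 1, 1, 1, 0⟩, ⟨1, 0, 0, 1, 0⟩],
      ![⟨1, 1, 0, 1, 0⟩, ⟨1, 0, 1, 1, 0⟩], ![⟨1, 1, 1, 1, 0⟩, ⟨1, 0, 0, 1, 0⟩],
      ![⟨1, 1, 0, 1, 0⟩, ⟨1, 0, 1, 1, 0⟩], ![⟨1, 0, 1, 1, 0⟩, ⟨1, 1, 0, 1, 0⟩]],
    ![![⟨2, 0, 0, -1, 0⟩, ⟨2, 1, -1, -1, 0⟩], ![⟨2, 1, -1, -1, 0⟩, ⟨2, 0, 0, -1, 0⟩],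
      ![⟨2, 1, 0, -1, 0⟩, ⟨2, 0, -1, -1, 0⟩], ![⟨2, 1, -1, -1, 0⟩, ⟨2, 0, 0, -1, 0⟩],
      ![⟨2, 1, 0, -1, 0⟩, ⟨2, 0, -1, -1, 0⟩], ![⟨2, 1, -1, -1, 0⟩, ⟨2, 0, 0, -1, 0⟩]]] i t

/-- Four directed Hamiltonian cycles of a doubled odd cycle. -/
def doubledOddCycle (i : Fin 4) (t : Fin 6) : Fin 2 → Step 2 :=
  ![
    ![![⟨1, 1, 0, 0, 0⟩, ⟨2, 1, 2, 0, -2⟩], ![⟨2, 1, 2, -1, -2⟩, ⟨1, 0, 0, 1, 0⟩],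
      ![⟨1, 1, 0, 1, 0⟩, ⟨2, 0, 2, -1, -2⟩], ![⟨2, 1, 2, -1, -2⟩, ⟨1, 0, 0, 1, 0⟩],
      ![⟨1, 1, 0, 1, 0⟩, ⟨2, 0, 2, -1, -2⟩], ![⟨2, 0, 1, 0, -1⟩, ⟨1, 0, 2, 0, -1⟩]],
    ![![⟨2, 0, 0, 0, 0⟩, ⟨1, 1, 0, 0, 2⟩], ![⟨2, 0, 2, -1, 0⟩, ⟨1, 1, 0, 1, 2⟩],
      ![⟨2, 0, 2, -1, 0⟩, ⟨1, 1, 0, 1, 2⟩], ![⟨2, 0, 2, -1, 0⟩, ⟨1, 1, 0, 1, 2⟩],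
      ![⟨2, 0, 2, -1, 0⟩, ⟨1, 1, 0, 1, 2⟩], ![⟨1, 1, 0, 0, 1⟩, ⟨2, 0, 1, 0, 1⟩]],
    ![![⟨1, 0, 0, 0, 0⟩, ⟨2, 0, 1, 0, 0⟩], ![⟨1, 1, 0, 1, 0⟩, ⟨2, 0, 2, -1, 0⟩],
      ![⟨2, 1, 2, -1, 0⟩, ⟨1, 0, 0, 1, 0⟩], ![⟨1, 1, 0, 1, 0⟩, ⟨2, 0, 2, -1, 0⟩],
      ![⟨2, 1, 2, -1, 0⟩, ⟨1, 0, 0, 1, 0⟩], ![⟨2, 1, 1, 0, 1⟩, ⟨1, 1, 1, 0, -1⟩]],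
    ![![⟨2, 1, 0, 0, 0⟩, ⟨1, 0, 1, 0, 0⟩], ![⟨1, 0, 1, 1, 0⟩, ⟨2, 1, 1, -1, 0⟩],
      ![⟨1, 0, 1, 1, 0⟩, ⟨2, 1, 1, -1, 0⟩], ![⟨1, 0, 1, 1, 0⟩, ⟨2, 1, 1, -1, 0⟩],
      ![⟨1, 0, 1, 1, 0⟩, ⟨2, 1, 1, -1, 0⟩], ![⟨1, 0, 2, 0, -1⟩, ⟨2, 1, 0, 0, 1⟩]]] i t

/-- Five directed Hamiltonian cycles of a doubled odd cycle with rungs. -/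
def doubledOddCycleRungs (i : Fin 5) (t : Fin 6) : Fin 2 → Step 2 :=
  ![
    ![![⟨1, 0, 0, 0, 0⟩, ⟨0, 0, 2, 0, -1⟩], ![⟨0, 1, 0, 0, 1⟩, ⟨1, 0, 0, 0, 2⟩],
      ![⟨0, 1, 0, 0, 3⟩, ⟨1, 1, 0, 0, 4⟩], ![⟨1, 0, 0, 2, 0⟩, ⟨0, 0, 0, 2, -1⟩],
      ![⟨0, 1, 0, 2, -1⟩, ⟨1, 1, 0, 2, 0⟩], ![⟨0, 1, 2, 0, -3⟩, ⟨1, 1, 2, 0, -2⟩]],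
    ![![⟨2, 0, 0, 0, 0⟩, ⟨1, 1, 0, 0, 2⟩], ![⟨1, 0, 0, 0, 5⟩, ⟨1, 1, 0, 0, 3⟩],
      ![⟨1, 0, 0, 0, 6⟩, ⟨2, 0, 0, 0, 4⟩], ![⟨0, 1, 0, 2, 1⟩, ⟨1, 1, 0, 2, 2⟩],
      ![⟨1, 0, 0, 2, 2⟩, ⟨0, 0, 0, 2, 1⟩], ![⟨1, 1, 0, 0, 1⟩, ⟨1, 0, 2, 0, -1⟩]],
    ![![⟨0, 1, 0, 0, 0⟩, ⟨1, 0, 0, 0, 1⟩], ![⟨1, 1, 0, 0, 2⟩, ⟨2, 0, 2, 0, -1⟩],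
      ![⟨2, 1, 2, 0, -2⟩, ⟨1, 0, 0, 0, 3⟩], ![⟨1, 1, 0, 1, 1⟩, ⟨2, 0, 2, -1, 0⟩],
      ![⟨2, 1, 2, -1, 0⟩, ⟨1, 0, 0, 1, 1⟩], ![⟨2, 1, 1, 0, 1⟩, ⟨0, 0, 1, 0, 0⟩]],
    ![![⟨1, 1, 0, 0, 0⟩, ⟨2, 1, 0, 0, 3⟩], ![⟨2, 1, 0, 0, 2⟩, ⟨0, 0, 0, 0, 1⟩],
      ![⟨1, 1, 1, 0, 2⟩, ⟨0, 0, 1, 0, 1⟩], ![⟨2, 1, 1, -1, 3⟩, ⟨1, 0, 1, 1, 0⟩],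
      ![⟨1, 1, 1, 1, 0⟩, ⟨2, 0, 1, -1, 3⟩], ![⟨1, 0, 2, 0, -1⟩, ⟨2, 0, 0, 0, 4⟩]],
    ![![⟨2, 1, 0, 0, 0⟩, ⟨2, 0, 1, 0, 0⟩], ![⟨2, 0, 2, 0, -1⟩, ⟨2, 1, 1, 0, -1⟩],
      ![⟨2, 0, 2, 0, -2⟩, ⟨2, 1, 1, 0, -2⟩], ![⟨2, 0, 2, -1, 0⟩, ⟨2, 1, 1, -1, 0⟩],
      ![⟨2, 0, 2, -1, 0⟩, ⟨2, 1, 1, -1, 0⟩], ![⟨2, 0, 1, 0, 1⟩, ⟨2, 1, 0, 0, 1⟩]]] i t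

/-- The arcs of the ladder; it is crossed between opposite rows, except at the first column. -/
def LadderLink (t : Fin 6) (d : Fin 3) (a b : Fin 4) : Prop :=
  if d = 0 then a ≠ b
  else if t = 0 then a.1 / 2 = d.1 % 2
  else if t = 1 ∧ d = 2 then b.1 / 2 = 1
  else if t = 5 ∧ d = 1 then b.1 / 2 = 0
  else a.1 / 2 ≠ b.1 / 2

instance (t : Fin 6) (d : Fin 3) (a b : Fin 4) : Decidable (LadderLink t d a b) := by
  unfold LadderLink; infer_instance

/-- Conditions making a table of steps describe `s` directed Hamiltonian cycles and `k - s`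
`K_2*`-factors. -/
def IsStripTable {k W : ℕ} (s : ℕ) (t : Fin 6) (T : Fin k → Fin 6 → Fin W → Step W) : Prop :=
  (∀ i : Fin k, i.1 < s → ∀ τ ∈ transitions t, τ.Advances (T i)) ∧
  ∀ i : Fin k, ¬ i.1 < s → ∀ τ ∈ transitions t, τ.Returns (T i)

instance {k W : ℕ} (s : ℕ) (t : Fin 6) (T : Fin k → Fin 6 → Fin W → Step W) :
    Decidable (IsStripTable s t T) := by
  unfold IsStripTable; infer_instance

namespace Packing

lemma strip_of_isStripTable {k W s n : ℕ} [NeZero W] (hn : 5 ≤ n) {t : Fin 6}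
    (ht : t = if n % 2 = 1 then 3 else 4) (L : Fin 6 → Fin 3 → Fin W → Fin W → Prop)
    (T : Fin k → Fin 6 → Fin W → Step W) (hs : s ≤ k)
    (hL : ∀ i t a, L t (T i t a).dir a (T i t a).row) (hL0 : ∀ t a, ¬ L t 0 a a)
    (hT : ∀ t a i i', (T i t a).dir = (T i' t a).dir → (T i t a).row = (T i' t a).row → i = i')
    (h : IsStripTable s t T) : Packing (W * n) (StripAdj (n := n) L) k s := by
  have : NeZero n := ⟨by omega⟩
  exact strip (by omega) L T hs hL hL0 hT
    (fun i hi => stripPos_stripMap _ hn ht (h.1 i hi))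
    fun i hi => stripMap_stripMap _ hn ht (h.2 i hi)

lemma ladder_seven {n : ℕ} (hn : 3 ≤ n) : Packing (4 * n) (StripAdj (n := n) LadderLink) 7 7 := by
  have hL : ∀ i t a, LadderLink t (ladderSeven i t a).dir a (ladderSeven i t a).row := by
    decide +kernel
  have hL0 : ∀ t a, ¬ LadderLink t 0 a a := by decide +kernel
  have hT : ∀ t a i i', (ladderSeven i t a).dir = (ladderSeven i' t a).dir →
      (ladderSeven i t a).row = (ladderSeven i' t a).row → i = i' := by decide +kernel
  obtain rfl | rfl | hn : n = 3 ∨ n = 4 ∨ 5 ≤ n := by omega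
  · exact strip (by omega) _ ladderSeven le_rfl hL hL0 hT (by decide +kernel) (by decide +kernel)
  · exact strip (by omega) _ ladderSeven le_rfl hL hL0 hT (by decide +kernel) (by decide +kernel)
  · refine strip_of_isStripTable hn rfl _ ladderSeven le_rfl hL hL0 hT ?_
    split_ifs <;> decide +kernel

lemma ladder_five {n : ℕ} (hn : 3 ≤ n) : Packing (4 * n) (StripAdj (n := n) LadderLink) 7 5 := by
  have hL : ∀ i t a, LadderLink t (ladderFive i t a).dir a (ladderFive i t a).row := by
    decide +kernel
  have hL0 : ∀ t a, ¬ LadderLink t 0 a a := by decide +kernel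
  have hT : ∀ t a i i', (ladderFive i t a).dir = (ladderFive i' t a).dir →
      (ladderFive i t a).row = (ladderFive i' t a).row → i = i' := by decide +kernel
  obtain rfl | rfl | hn : n = 3 ∨ n = 4 ∨ 5 ≤ n := by omega
  · exact strip (by omega) _ ladderFive (by omega) hL hL0 hT (by decide +kernel)
      (by decide +kernel)
  · exact strip (by omega) _ ladderFive (by omega) hL hL0 hT (by decide +kernel)
      (by decide +kernel)
  · refine strip_of_isStripTable hn rfl _ ladderFive (by omega) hL hL0 hT ?_
    split_ifs <;> decide +kernel

lemma doubled_cycle {n : ℕ} (hn : 5 ≤ n) :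
    Packing (2 * n) (StripAdj (n := n) (W := 2) fun _ d _ _ => d ≠ 0) 4 4 := by
  by_cases h : n % 2 = 1
  · exact strip_of_isStripTable hn (if_pos h).symm _ doubledOddCycle le_rfl (by decide +kernel)
      (by decide +kernel) (by decide +kernel) (by decide +kernel)
  · exact strip_of_isStripTable hn (if_neg h).symm _ doubledEvenCycle le_rfl (by decide +kernel)
      (by decide +kernel) (by decide +kernel) (by decide +kernel)

lemma doubled_odd_cycle_rungs {n : ℕ} (hn : 5 ≤ n) (h : n % 2 = 1) :
    Packing (2 * n) (StripAdj (n := n) (W := 2) fun _ d a b => d = 0 → a ≠ b) 5 5 :=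
  strip_of_isStripTable hn (if_pos h).symm _ doubledOddCycleRungs le_rfl (by decide +kernel)
    (by decide +kernel) (by decide +kernel) (by decide +kernel)

end Packing

/-- The points of the ladder in the coordinates of the Walecki decomposition. -/
def ladderPoint (n : ℕ) (x : Fin n × Fin 4) : Option (ZMod (2 * n - 1)) × Fin 2 :=
  (zigzag (2 * n - 1) ⟨2 * x.1.1 + x.2.1 / 2, by have := x.1.2; have := x.2.2; omega⟩,
    ⟨x.2.1 % 2, by omega⟩)

lemma ladderPoint_injective (n : ℕ) : Injective (ladderPoint n) := by
  rintro ⟨j, a⟩ ⟨j', a'⟩ h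
  have h1 := congrArg Fin.val (zigzag_injective _ (congrArg Prod.fst h))
  have h2 := congrArg (fun x => x.2.1) h
  have := a.2
  have := a'.2
  simp only [ladderPoint] at h1 h2
  ext <;> simp only <;> omega

lemma sumRel_zigzag_neg_one {n : ℕ} (hn : 3 ≤ n) {p q : Fin (2 * n - 1 + 1)}
    (h : 0 < p.1 ∧ p.1 % 2 = 0 ∧ q.1 = p.1 + 3 ∨ p.1 = 1 ∧ q.1 = 3 ∨
      p.1 = 0 ∧ q.1 + 2 = 2 * n) : SumRel (-1) (zigzag (2 * n - 1) p) (zigzag (2 * n - 1) q) := by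
  have hne : zigzag (2 * n - 1) p ≠ zigzag (2 * n - 1) q := fun h => by
    have := congrArg Fin.val (zigzag_injective _ h)
    omega
  rcases h with ⟨h0, h1, h2⟩ | ⟨h1, h2⟩ | ⟨h1, h2⟩
  · obtain ⟨k, hk⟩ : ∃ k, p.1 = 2 * k := ⟨p.1 / 2, by omega⟩
    rw [zigzag_even (k := k) (by omega) hk, zigzag_odd (k := k + 1) (by omega)] at hne ⊢
    exact ⟨fun h => hne (congrArg some h), by push_cast; ring⟩
  · rw [zigzag_odd (k := 0) (by omega), zigzag_odd (k := 1) (by omega)] at hne ⊢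
    exact ⟨fun h => hne (congrArg some h), by simp⟩
  · rw [zigzag_zero h1, zigzag_even (k := n - 1) (by omega) (by omega)]
    have : ((n - 1 + (n - 1) + 1 : ℕ) : ZMod (2 * n - 1)) = 0 := by
      rw [show n - 1 + (n - 1) + 1 = 2 * n - 1 by omega, ZMod.natCast_self]
    change ((n - 1 : ℕ) : ZMod (2 * n - 1)) + ((n - 1 : ℕ) : ZMod (2 * n - 1)) = -1
    push_cast at this
    linear_combination this

/-- The forward arcs of the ladder between the columns `j` and `j'`, where `r` and `r'` are the
halves of the rows. -/
def LadderForward (n j r j' r' : ℕ) : Prop :=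
  j = 0 ∧ j' = 1 ∧ r = 1 ∨ j + 1 = n ∧ j' = 0 ∧ r' = 0 ∨ 0 < j ∧ j' = j + 1 ∧ r + r' = 1

lemma LadderForward.sumRel {n j r j' r' : ℕ} (hn : 3 ≤ n) (h : LadderForward n j r j' r')
    (hr : r < 2) (hr' : r' < 2) {p q : Fin (2 * n - 1 + 1)} (hp : p.1 = 2 * j + r)
    (hq : q.1 = 2 * j' + r') :
    SumRel (-1) (zigzag (2 * n - 1) p) (zigzag (2 * n - 1) q) ∨
    SumRel 0 (zigzag (2 * n - 1) p) (zigzag (2 * n - 1) q) ∨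
    SumRel 1 (zigzag (2 * n - 1) p) (zigzag (2 * n - 1) q) := by
  have hup : (up p).1 = if p.1 + 1 < 2 * n - 1 + 1 then p.1 + 1 else 0 := up_val p
  have key : q.1 = (up p).1 ∨
      (0 < p.1 ∧ p.1 % 2 = 0 ∧ q.1 = p.1 + 3 ∨ p.1 = 1 ∧ q.1 = 3 ∨
        p.1 = 0 ∧ q.1 + 2 = 2 * n) ∨
      (0 < q.1 ∧ q.1 % 2 = 0 ∧ p.1 = q.1 + 3 ∨ q.1 = 1 ∧ p.1 = 3 ∨
        q.1 = 0 ∧ p.1 + 2 = 2 * n) := by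
    have hp2 := p.2
    have hq2 := q.2
    rw [hup]
    rcases h with ⟨h1, h2, h3⟩ | ⟨h1, h2, h3⟩ | ⟨h1, h2, h3⟩
    · by_cases h : r' = 0
      · left; rw [if_pos (by omega)]; omega
      · exact Or.inr (Or.inl (Or.inr (Or.inl (by omega))))
    · by_cases h : r = 0
      · exact Or.inr (Or.inr (Or.inr (Or.inr (by omega))))
      · left; rw [if_neg (by omega)]; omega
    · by_cases h : r = 0
      · exact Or.inr (Or.inl (Or.inl (by omega)))
      · left; rw [if_pos (by omega)]; omega
  rcases key with h | h | h
  · obtain rfl : q = up p := Fin.ext h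
    exact Or.inr (sumRel_zigzag_up (by omega) p)
  · exact Or.inl (sumRel_zigzag_neg_one hn h)
  · exact Or.inl (sumRel_zigzag_neg_one hn h).symm

lemma StripAdj.ladderForward {n : ℕ} (hn : 3 ≤ n) {x y : Fin n × Fin 4}
    (h : StripAdj LadderLink x y) : y.1 = x.1 ∨
    LadderForward n x.1 (x.2 / 2) y.1 (y.2 / 2) ∨ LadderForward n y.1 (y.2 / 2) x.1 (x.2 / 2) := by
  obtain ⟨d, hd, hL⟩ := h
  have hx := x.1.2
  have ha : x.2.1 / 2 < 2 := by omega
  have hb : y.2.1 / 2 < 2 := by omega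
  have hc := colType_cases x.1
  unfold LadderLink at hL
  generalize colType x.1 = c at hL hc
  generalize x.2.1 / 2 = r at *
  generalize y.2.1 / 2 = r' at *
  fin_cases d
  · exact Or.inl hd
  · have hd : y.1.1 = (up x.1).1 := congrArg _ hd
    rw [up_val] at hd
    refine Or.inr (Or.inl ?_)
    unfold LadderForward
    generalize x.1.1 = j at *
    generalize y.1.1 = j' at *
    rcases hc with ⟨h, rfl⟩ | ⟨h, h', rfl⟩ |
      ⟨h, ⟨h', rfl⟩ | ⟨h', rfl⟩ | ⟨h', h'', rfl⟩ | ⟨h', h'', rfl⟩⟩ <;> simp at hL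
    · rw [if_pos (by omega)] at hd; left; omega
    · rw [if_neg (by omega)] at hd; right; left; omega
    all_goals rw [if_pos (by omega)] at hd; right; right; omega
  · have hd : y.1.1 = (down x.1).1 := congrArg _ hd
    rw [down_val] at hd
    refine Or.inr (Or.inr ?_)
    unfold LadderForward
    generalize x.1.1 = j at *
    generalize y.1.1 = j' at *
    rcases hc with ⟨h, rfl⟩ | ⟨h, h', rfl⟩ |
      ⟨h, ⟨h', rfl⟩ | ⟨h', rfl⟩ | ⟨h', h'', rfl⟩ | ⟨h', h'', rfl⟩⟩ <;> simp at hL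
    · rw [if_pos (by omega)] at hd; right; left; omega
    · rw [if_neg (by omega)] at hd; right; right; omega
    · rw [if_neg (by omega)] at hd; left; omega
    all_goals rw [if_neg (by omega)] at hd; right; right; omega

lemma sumRel_ladderPoint {n : ℕ} (hn : 3 ≤ n) {x y : Fin n × Fin 4} (h : StripAdj LadderLink x y) :
    (ladderPoint n x).1 = (ladderPoint n y).1 ∧ ladderPoint n x ≠ ladderPoint n y ∨
    SumRel (-1) (ladderPoint n x).1 (ladderPoint n y).1 ∨
    SumRel 0 (ladderPoint n x).1 (ladderPoint n y).1 ∨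
    SumRel 1 (ladderPoint n x).1 (ladderPoint n y).1 := by
  have hxy : x ≠ y := by
    rintro rfl
    obtain ⟨d, h, hd⟩ := h
    obtain rfl : d = 0 := shift_injective hn x.1 (h.symm.trans (by simp [shift]))
    exact (if_pos rfl).mp hd rfl
  by_cases h1 : (ladderPoint n x).1 = (ladderPoint n y).1
  · exact Or.inl ⟨h1, fun h => hxy (ladderPoint_injective n h)⟩
  refine Or.inr ?_
  have ha : x.2.1 / 2 < 2 := by omega
  have hb : y.2.1 / 2 < 2 := by omega
  rcases h.ladderForward hn with h | h | h
  · have h2 : x.2.1 / 2 ≠ y.2.1 / 2 := fun h2 => h1 (by simp only [ladderPoint, h, h2])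
    have hv : y.1.1 = x.1.1 := congrArg _ h
    have hup : ∀ p q : Fin (2 * n - 1 + 1), p.1 = 2 * x.1.1 → q.1 = 2 * x.1.1 + 1 → q = up p :=
      fun p q hp hq => Fin.ext (by rw [up_val, if_pos (by omega)]; omega)
    rcases Nat.lt_or_ge (x.2.1 / 2) 1 with h3 | h3
    · have := sumRel_zigzag_up (N := 2 * n - 1) (by omega)
        ⟨2 * x.1.1 + x.2.1 / 2, by omega⟩
      rw [← hup _ ⟨2 * y.1.1 + y.2.1 / 2, by omega⟩ (by simp only; omega)
        (by simp only; omega)] at this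
      exact Or.inr this
    · have := sumRel_zigzag_up (N := 2 * n - 1) (by omega)
        ⟨2 * y.1.1 + y.2.1 / 2, by omega⟩
      rw [← hup _ ⟨2 * x.1.1 + x.2.1 / 2, by omega⟩ (by simp only; omega)
        (by simp only; omega)] at this
      exact Or.inr (this.imp SumRel.symm SumRel.symm)
  · exact h.sumRel hn ha hb rfl rfl
  · exact (h.sumRel hn hb ha rfl rfl).imp SumRel.symm (Or.imp SumRel.symm SumRel.symm)

namespace Packing

section doubled

variable {N g m : ℕ}

lemma doubled_sumRel (hN : N = 2 * g + 1) (t : ZMod N) :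
    Packing m (fun x y : Option (ZMod N) × Fin 2 => SumRel t x.1 y.1) 2 0 := by
  refine of_pred (ι := Fin 2) (fun _ => False) (fun i x => (pairing g t x.1, x.2 + i)) (by simp)
    (by simp) (fun i x _ => minimalPeriod_eq_two (fun x => ?_) (fun x h => ?_) x) (by simp)
    (fun _ x => sumRel_pairing hN t x.1) fun x i j h => add_left_cancel (congrArg Prod.snd h)
  · have : ∀ a i : Fin 2, a + i + i = a := by decide
    exact Prod.ext (pairing_pairing hN t _) (this _ _)
  · exact (sumRel_pairing hN t x.1).ne (congrArg Prod.fst h).symm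

lemma doubled_hamiltonian (hN : 4 ≤ N) (i : ℕ) :
    Packing (2 * (N + 1)) (fun x y : Option (ZMod N) × Fin 2 =>
      SumRel ((2 * i : ℕ) : ZMod N) x.1 y.1 ∨ SumRel ((2 * i + 1 : ℕ) : ZMod N) x.1 y.1) 4 4 := by
  have : NeZero N := ⟨by omega⟩
  refine (doubled_cycle (n := N + 1) (by omega)).congr
    ((walecki N i).prodCongr (Equiv.refl _)) fun x y ⟨d, h, hd⟩ => ?_
  have hxy : CycAdj x.1 y.1 := by
    fin_cases d
    · exact absurd rfl hd
    · exact Or.inl h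
    · exact Or.inr h
  have := sumRel_walecki (by omega) (i : ZMod N) hxy
  push_cast
  exact this

lemma doubled_two (hN : N = 2 * g + 1) (hg : 2 ≤ g) (i : ℕ) (hi : 2 * i + 1 < N)
    (P : Prop) [Decidable P] :
    Packing (2 * (N + 1)) (fun x y : Option (ZMod N) × Fin 2 =>
      SumRel ((2 * i : ℕ) : ZMod N) x.1 y.1 ∨ SumRel ((2 * i + 1 : ℕ) : ZMod N) x.1 y.1)
      4 (if P then 4 else 0) := by
  split_ifs
  · exact doubled_hamiltonian (by omega) i
  · exact (doubled_sumRel hN _).union (doubled_sumRel hN _) fun x y h h' => by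
      have := h.unique_natCast (by omega) (by omega) h'
      omega

end doubled

/-- `K_{4n}*` has factorizations into `K_2*`-factors and an odd number `s ≥ 5` of directed
Hamiltonian cycles. -/
lemma hamiltonian_odd {n s : ℕ} (hn : 3 ≤ n) (hs : Odd s) (hs5 : 5 ≤ s) (hs' : s ≤ 4 * n - 1) :
    Packing (4 * n) (fun x y : Option (ZMod (2 * n - 1)) × Fin 2 => x ≠ y) (4 * n - 1) s := by
  have hN : 2 * n - 1 = 2 * (n - 1) + 1 := by omega
  have h0 : ∀ s', (s' = 5 ∨ s' = 7) → Packing (4 * n)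
      (fun x y : Option (ZMod (2 * n - 1)) × Fin 2 => x.1 = y.1 ∧ x ≠ y ∨
        SumRel (-1) x.1 y.1 ∨ SumRel 0 x.1 y.1 ∨ SumRel 1 x.1 y.1) 7 s' := by
    have : NeZero (2 * n - 1) := ⟨by omega⟩
    intro s' hs'
    have hb : Bijective (ladderPoint n) :=
      (Fintype.bijective_iff_injective_and_card _).2 ⟨ladderPoint_injective n, by
        simp only [Fintype.card_prod, Fintype.card_fin, Fintype.card_option, ZMod.card]; omega⟩
    refine Packing.congr (Equiv.ofBijective _ hb)
      (fun x y => sumRel_ladderPoint hn) ?_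
    rcases hs' with rfl | rfl
    · exact ladder_five hn
    · exact ladder_seven hn
  obtain ⟨e, s', he, hs'', rfl⟩ : ∃ e s', e ≤ n - 2 ∧ (s' = 5 ∨ s' = 7) ∧ s = s' + 4 * e := by
    obtain ⟨k, rfl⟩ := hs
    by_cases h : k % 2 = 0
    · exact ⟨(k - 2) / 2, 5, by omega, by simp, by omega⟩
    · exact ⟨(k - 3) / 2, 7, by omega, by simp, by omega⟩
  have hm : 2 * (2 * n - 1 + 1) = 4 * n := by omega
  have h1 := iUnion (fun i (x y : Option (ZMod (2 * n - 1)) × Fin 2) =>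
      SumRel ((2 * (i + 1) : ℕ) : ZMod (2 * n - 1)) x.1 y.1 ∨
      SumRel ((2 * (i + 1) + 1 : ℕ) : ZMod (2 * n - 1)) x.1 y.1) (fun _ => 4)
    (fun i => if i < e then 4 else 0) (n - 2)
    (fun i hi => doubled_two hN (by omega) (i + 1) (by omega) (i < e)) (by
      intro t ht u hu htu x y h h'
      rcases h with h | h <;> rcases h' with h' | h' <;>
      · have := h.unique_natCast (by omega) (by omega) h'
        omega)
  rw [sum_range_ite_lt, min_eq_left he, hm] at h1
  have h2 := (h0 s' hs'').union h1 (by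
    have hneg : (-1 : ZMod (2 * n - 1)) = ((2 * n - 2 : ℕ) : ZMod (2 * n - 1)) := by
      have : ((2 * n - 2 + 1 : ℕ) : ZMod (2 * n - 1)) = 0 := by
        rw [show 2 * n - 2 + 1 = 2 * n - 1 by omega, ZMod.natCast_self]
      push_cast at this
      linear_combination -this
    have h0 : (0 : ZMod (2 * n - 1)) = (0 : ℕ) := by simp
    have h1 : (1 : ZMod (2 * n - 1)) = (1 : ℕ) := by simp
    rw [hneg, h0, h1]
    rintro x y h ⟨t, ht, h'⟩
    rcases h with h | h | h | h <;> rcases h' with h' | h'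
    · exact h'.ne h.1
    · exact h'.ne h.1
    all_goals
    · have := h.unique_natCast (by omega) (by omega) h'
      omega)
  simp only [Finset.sum_const, Finset.card_range, smul_eq_mul] at h2
  rw [show 7 + (n - 2) * 4 = 4 * n - 1 by omega] at h2
  refine h2.mono fun x y h => ?_
  rcases h with (h | h | h | h) | ⟨t, _, h | h⟩
  · exact h.2
  all_goals exact fun hxy => h.ne (congrArg Prod.fst hxy)

/-- For odd `n`, `K_{2n}*` decomposes into directed Hamiltonian cycles. -/
lemma hamiltonian_all {n : ℕ} (hn : 5 ≤ n) (hodd : n % 2 = 1) :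
    Packing (2 * n) (fun x y : Option (ZMod (n - 1)) × Fin 2 => x ≠ y) (2 * n - 1) (2 * n - 1) := by
  obtain ⟨k, rfl⟩ : ∃ k, n = 2 * k + 1 := ⟨n / 2, by omega⟩
  rw [show 2 * k + 1 - 1 = 2 * k by omega]
  have : NeZero (2 * k) := ⟨by omega⟩
  have h0 : Packing (2 * (2 * k + 1)) (fun x y : Option (ZMod (2 * k)) × Fin 2 =>
      x.1 = y.1 ∧ x ≠ y ∨ SumRel (0 : ℕ) x.1 y.1 ∨ SumRel (1 : ℕ) x.1 y.1) 5 5 := by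
    refine (doubled_odd_cycle_rungs hn hodd).congr
      ((walecki (2 * k) 0).prodCongr (Equiv.refl _)) fun x y ⟨d, h, hd⟩ => ?_
    by_cases hd0 : d = 0
    · subst hd0
      refine Or.inl ⟨congrArg (walecki (2 * k) 0) h.symm, fun hxy => hd rfl ?_⟩
      exact congrArg Prod.snd (Equiv.injective _ hxy)
    · right
      have hxy : CycAdj x.1 y.1 := by
        fin_cases d
        · exact absurd rfl hd0
        · exact Or.inl h
        · exact Or.inr h
      have := sumRel_walecki (by omega) (0 : ZMod (2 * k)) hxy
      push_cast
      simpa using this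
  have h1 := iUnion (fun i (x y : Option (ZMod (2 * k)) × Fin 2) =>
      SumRel ((2 * (i + 1) : ℕ) : ZMod (2 * k)) x.1 y.1 ∨
      SumRel ((2 * (i + 1) + 1 : ℕ) : ZMod (2 * k)) x.1 y.1) (fun _ => 4) (fun _ => 4) (k - 1)
    (fun i hi => doubled_hamiltonian (by omega) (i + 1)) (by
      intro t ht u hu htu x y h h'
      rcases h with h | h <;> rcases h' with h' | h' <;>
      · have := h.unique_natCast (by omega) (by omega) h'
        omega)
  have h2 := h0.union h1 (by
    rintro x y h ⟨t, ht, h'⟩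
    rcases h with h | h | h <;> rcases h' with h' | h'
    · exact h'.ne h.1
    · exact h'.ne h.1
    all_goals
    · have := h.unique_natCast (by omega) (by omega) h'
      omega)
  simp only [Finset.sum_const, Finset.card_range, smul_eq_mul] at h2
  rw [show 5 + (k - 1) * 4 = 2 * (2 * k + 1) - 1 by omega] at h2
  refine h2.mono fun x y h => ?_
  rcases h with (h | h | h) | ⟨t, _, h | h⟩
  · exact h.2
  all_goals exact fun hxy => h.ne (congrArg Prod.fst hxy)

end Packing

lemma minimalPeriod_eq_of_iterate_ne {α : Type*} {f : α → α} {m : ℕ} {x : α} (hm : 0 < m)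
    (h : f^[m] x = x) (h' : ∀ l : Fin m, 0 < l.1 → f^[l] x ≠ x) : minimalPeriod f x = m := by
  have hp : IsPeriodicPt f m x := h
  by_contra hne
  exact h' ⟨_, lt_of_le_of_ne (hp.minimalPeriod_le hm) hne⟩ (hp.minimalPeriod_pos hm)
    iterate_minimalPeriod

/-- The factors of a factorization of `K_8*` into 4 `K_2*`-factors and 3 `C⃗_4`-factors. -/
def octetFourThree : Fin 7 → Fin 8 → Fin 8 :=
  ![![1, 0, 3, 2, 5, 4, 7, 6], ![2, 3, 0, 1, 6, 7, 4, 5], ![3, 2, 1, 0, 7, 6, 5, 4],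
    ![4, 5, 6, 7, 0, 1, 2, 3], ![5, 4, 7, 6, 2, 3, 0, 1], ![6, 7, 4, 5, 3, 2, 1, 0],
    ![7, 6, 5, 4, 1, 0, 3, 2]]

/-- The factors of a factorization of `K_8*` into 2 `K_2*`-factors and 5 `C⃗_4`-factors. -/
def octetFourFive : Fin 7 → Fin 8 → Fin 8 :=
  ![![7, 6, 5, 4, 3, 2, 1, 0], ![5, 3, 7, 1, 6, 0, 4, 2], ![4, 2, 3, 7, 5, 6, 0, 1],
    ![6, 7, 4, 5, 0, 1, 2, 3], ![2, 5, 6, 0, 1, 7, 3, 4], ![1, 4, 0, 6, 2, 3, 7, 5],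
    ![3, 0, 1, 2, 7, 4, 5, 6]]

/-- The factors of a factorization of `K_8*` into 7 `C⃗_4`-factors. -/
def octetFourSeven : Fin 7 → Fin 8 → Fin 8 :=
  ![![4, 2, 3, 7, 5, 6, 0, 1], ![7, 3, 5, 4, 6, 0, 1, 2], ![5, 6, 7, 1, 3, 2, 4, 0],
    ![6, 7, 4, 5, 0, 1, 2, 3], ![2, 5, 6, 0, 1, 7, 3, 4], ![1, 4, 0, 6, 2, 3, 7, 5],
    ![3, 0, 1, 2, 7, 4, 5, 6]]

/-- The factors of a factorization of `K_8*` into 2 `K_2*`-factors and 5 `C⃗_8`-factors. -/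
def octetEightFive : Fin 7 → Fin 8 → Fin 8 :=
  ![![6, 5, 4, 7, 2, 1, 0, 3], ![5, 4, 7, 6, 1, 0, 3, 2], ![1, 6, 3, 4, 5, 7, 2, 0],
    ![2, 3, 5, 0, 7, 6, 4, 1], ![3, 7, 6, 5, 0, 2, 1, 4], ![4, 2, 0, 1, 6, 3, 7, 5],
    ![7, 0, 1, 2, 3, 4, 5, 6]]

/-- The factors of a factorization of `K_8*` into 7 `C⃗_8`-factors. -/
def octetEightSeven : Fin 7 → Fin 8 → Fin 8 :=
  ![![6, 4, 3, 5, 7, 0, 1, 2], ![5, 3, 4, 7, 1, 6, 2, 0], ![3, 6, 7, 4, 5, 2, 0, 1],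
    ![2, 7, 5, 6, 0, 1, 4, 3], ![1, 5, 6, 0, 2, 7, 3, 4], ![4, 2, 0, 1, 6, 3, 7, 5],
    ![7, 0, 1, 2, 3, 4, 5, 6]]

/-- The factors of a factorization of `K_12*` into 4 `K_2*`-factors and 7 `C⃗_4`-factors. -/
def dozenFourSeven : Fin 11 → Fin 12 → Fin 12 :=
  ![![1, 0, 10, 6, 11, 9, 3, 8, 7, 5, 2, 4], ![8, 5, 4, 7, 2, 1, 9, 3, 0, 6, 11, 10],
    ![7, 11, 5, 8, 6, 2, 4, 0, 3, 10, 9, 1], ![9, 8, 11, 10, 5, 4, 7, 6, 1, 0, 3, 2],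
    ![11, 7, 9, 4, 0, 6, 8, 2, 10, 1, 5, 3], ![5, 9, 8, 2, 3, 7, 1, 10, 4, 11, 0, 6],
    ![10, 4, 0, 1, 9, 8, 2, 5, 11, 3, 6, 7], ![2, 6, 1, 11, 10, 3, 0, 9, 5, 4, 7, 8],
    ![4, 3, 7, 0, 1, 10, 5, 11, 6, 2, 8, 9], ![3, 2, 6, 5, 8, 11, 10, 4, 9, 7, 1, 0],
    ![6, 10, 3, 9, 7, 0, 11, 1, 2, 8, 4, 5]]

/-- The factors of a factorization of `K_12*` into 2 `K_2*`-factors and 9 `C⃗_4`-factors. -/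
def dozenFourNine : Fin 11 → Fin 12 → Fin 12 :=
  ![![2, 5, 0, 10, 8, 1, 11, 9, 4, 7, 3, 6], ![8, 2, 1, 5, 11, 3, 7, 6, 0, 10, 9, 4],
    ![3, 0, 10, 6, 5, 2, 1, 8, 9, 11, 4, 7], ![10, 6, 3, 1, 9, 7, 2, 4, 11, 5, 8, 0],
    ![5, 8, 9, 0, 7, 11, 10, 2, 6, 4, 1, 3], ![1, 4, 5, 7, 10, 6, 8, 11, 2, 3, 0, 9],
    ![4, 10, 7, 11, 6, 8, 9, 1, 3, 0, 2, 5], ![6, 9, 11, 8, 0, 4, 5, 3, 10, 2, 7, 1],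
    ![11, 3, 4, 2, 1, 9, 0, 5, 7, 8, 6, 10], ![7, 11, 8, 9, 3, 0, 4, 10, 1, 6, 5, 2],
    ![9, 7, 6, 4, 2, 10, 3, 0, 5, 1, 11, 8]]

/-- The factors of a factorization of `K_12*` into 11 `C⃗_4`-factors. -/
def dozenFourEleven : Fin 11 → Fin 12 → Fin 12 :=
  ![![6, 5, 4, 1, 10, 7, 9, 3, 0, 8, 11, 2], ![2, 10, 5, 6, 11, 9, 1, 8, 4, 0, 3, 7],
    ![7, 6, 10, 9, 3, 2, 0, 1, 5, 11, 8, 4], ![8, 9, 0, 4, 1, 11, 10, 2, 7, 3, 5, 6],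
    ![5, 4, 6, 0, 7, 8, 11, 10, 3, 2, 1, 9], ![10, 7, 8, 2, 0, 1, 3, 11, 6, 4, 9, 5],
    ![11, 3, 1, 8, 9, 4, 5, 0, 2, 6, 7, 10], ![4, 0, 11, 10, 8, 6, 7, 9, 1, 5, 2, 3],
    ![1, 8, 9, 7, 5, 3, 2, 4, 11, 10, 6, 0], ![3, 11, 7, 5, 2, 10, 4, 6, 9, 1, 0, 8],
    ![9, 2, 3, 11, 6, 0, 8, 5, 10, 7, 4, 1]]

/-- The factors of a factorization of `K_12*` into 11 `C⃗_6`-factors. -/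
def dozenSixEleven : Fin 11 → Fin 12 → Fin 12 :=
  ![![9, 8, 10, 11, 7, 6, 4, 3, 0, 2, 1, 5], ![11, 10, 6, 7, 9, 8, 1, 5, 4, 3, 0, 2],
    ![7, 9, 11, 6, 8, 10, 5, 2, 3, 0, 4, 1], ![10, 6, 0, 8, 11, 3, 7, 4, 2, 1, 5, 9],
    ![1, 11, 7, 4, 6, 9, 0, 8, 5, 10, 2, 3], ![8, 2, 9, 10, 5, 7, 3, 1, 6, 4, 11, 0],
    ![3, 0, 8, 9, 1, 4, 2, 6, 11, 5, 7, 10], ![6, 4, 1, 5, 10, 2, 9, 0, 7, 11, 3, 8],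
    ![2, 7, 5, 0, 3, 11, 8, 10, 1, 6, 9, 4], ![4, 5, 3, 1, 2, 0, 10, 11, 9, 7, 8, 6],
    ![5, 3, 4, 2, 0, 1, 11, 9, 10, 8, 6, 7]]

namespace Packing

lemma of_table {k n m : ℕ} (s : ℕ) (T : Fin k → Fin n → Fin n) (hm : 0 < m) (hs : s ≤ k)
    (h2 : ∀ (i : Fin k) x, i.1 < k - s → T i (T i x) = x)
    (hT : ∀ (i : Fin k) x, k - s ≤ i.1 →
      (T i)^[m] x = x ∧ ∀ l : Fin m, 0 < l.1 → (T i)^[l] x ≠ x)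
    (hne : ∀ i x, T i x ≠ x) (hinj : ∀ x i j, T i x = T j x → i = j) :
    Packing m (fun x y : Fin n => x ≠ y) k s := by
  refine of_pred (fun i : Fin k => k - s ≤ i.1) T ?_ (Fintype.card_fin k)
    (fun i x hi => minimalPeriod_eq_two (fun x => h2 i x (by omega)) (hne i) x)
    (fun i x hi => minimalPeriod_eq_of_iterate_ne hm (hT i x hi).1 (hT i x hi).2)
    (fun i x => (hne i x).symm) hinj
  have : Fintype.card {i : Fin k // i.1 < k - s} = k - s := by
    rw [Fintype.card_congr (Fin.castLEquiv (Nat.sub_le k s)).symm, Fintype.card_fin]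
  have h := Fintype.card_subtype_compl (fun i : Fin k => i.1 < k - s)
  simp only [not_lt, this, Fintype.card_fin] at h
  rw [h]
  omega

lemma octet_four {s : ℕ} (hs : s = 3 ∨ s = 5 ∨ s = 7) :
    Packing 4 (fun x y : Fin 8 => x ≠ y) 7 s := by
  rcases hs with rfl | rfl | rfl
  · refine of_table 3 octetFourThree (by omega) (by omega) ?_ ?_ ?_ ?_ <;> decide +kernel
  · refine of_table 5 octetFourFive (by omega) (by omega) ?_ ?_ ?_ ?_ <;> decide +kernel
  · refine of_table 7 octetFourSeven (by omega) (by omega) ?_ ?_ ?_ ?_ <;> decide +kernel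

lemma octet_eight {s : ℕ} (hs : s = 5 ∨ s = 7) :
    Packing 8 (fun x y : Fin 8 => x ≠ y) 7 s := by
  rcases hs with rfl | rfl
  · refine of_table 5 octetEightFive (by omega) (by omega) ?_ ?_ ?_ ?_ <;> decide +kernel
  · refine of_table 7 octetEightSeven (by omega) (by omega) ?_ ?_ ?_ ?_ <;> decide +kernel

lemma dozen_four {s : ℕ} (hs : s = 7 ∨ s = 9 ∨ s = 11) :
    Packing 4 (fun x y : Fin 12 => x ≠ y) 11 s := by
  rcases hs with rfl | rfl | rfl
  · refine of_table 7 dozenFourSeven (by omega) (by omega) ?_ ?_ ?_ ?_ <;> decide +kernel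
  · refine of_table 9 dozenFourNine (by omega) (by omega) ?_ ?_ ?_ ?_ <;> decide +kernel
  · refine of_table 11 dozenFourEleven (by omega) (by omega) ?_ ?_ ?_ ?_ <;> decide +kernel

lemma dozen_six : Packing 6 (fun x y : Fin 12 => x ≠ y) 11 11 := by
  refine of_table 11 dozenSixEleven (by omega) (by omega) ?_ ?_ ?_ ?_ <;> decide +kernel

lemma bipartite_four {s : ℕ} (hs : Even s) (hs' : s ≤ 4) :
    Packing 4 (fun p q : Bool × ZMod 4 => p.1 ≠ q.1) 4 s := by
  have h2 : addOrderOf (2 : ZMod 4) = 2 := addOrderOf_eq_prime (by decide) (by decide)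
  obtain ⟨e, hinj, hcard, hval⟩ : ∃ e : ZMod 4 → ZMod 4, Injective e ∧
      Fintype.card {p // e p ≠ p} = s ∧ ∀ p, e p ≠ p → e p - p = 2 := by
    obtain rfl | rfl | rfl : s = 0 ∨ s = 2 ∨ s = 4 := by obtain ⟨k, rfl⟩ := hs; omega
    · exact ⟨fun p => p, by decide, by decide, by decide⟩
    · exact ⟨fun p => if p = 0 ∨ p = 2 then p + 2 else p, by decide, by decide, by decide⟩
    · exact ⟨fun p => p + 2, by decide, by decide, by decide⟩
  exact bipartite_of_perm e hinj hcard fun p hp => by rw [hval p hp, h2]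

lemma bipartite_six_four {s : ℕ} (hs : Even s) (hs' : s ≤ 6) :
    Packing 4 (fun p q : Bool × ZMod 6 => p.1 ≠ q.1) 6 s := by
  have h3 : addOrderOf (3 : ZMod 6) = 2 := addOrderOf_eq_prime (by decide) (by decide)
  obtain ⟨e, hinj, hcard, hval⟩ : ∃ e : ZMod 6 → ZMod 6, Injective e ∧
      Fintype.card {p // e p ≠ p} = s ∧ ∀ p, e p ≠ p → e p - p = 3 := by
    obtain rfl | rfl | rfl | rfl : s = 0 ∨ s = 2 ∨ s = 4 ∨ s = 6 := by obtain ⟨k, rfl⟩ := hs; omega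
    · exact ⟨fun p => p, by decide, by decide, by decide⟩
    · exact ⟨fun p => if p = 0 ∨ p = 3 then p + 3 else p, by decide, by decide, by decide⟩
    · exact ⟨fun p => if p = 2 ∨ p = 5 then p else p + 3, by decide, by decide, by decide⟩
    · exact ⟨fun p => p + 3, by decide, by decide, by decide⟩
  exact bipartite_of_perm e hinj hcard fun p hp => by rw [hval p hp, h3]

lemma bipartite_six_six : Packing 6 (fun p q : Bool × ZMod 6 => p.1 ≠ q.1) 6 6 := by
  have h2 : addOrderOf (2 : ZMod 6) = 3 := addOrderOf_eq_prime (by decide) (by decide)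
  refine bipartite_of_perm (fun p => p + 2) (by decide) (by decide) fun p _ => ?_
  rw [add_sub_cancel_left, h2]

end Packing

lemma exists_even_sum {h : ℕ} (hh : Even h) (k T : ℕ) (hT : Even T) (hTk : T ≤ k * h) :
    ∃ c : ℕ → ℕ, (∀ t, Even (c t) ∧ c t ≤ h) ∧ ∑ t ∈ Finset.range k, c t = T := by
  induction k generalizing T with
  | zero => exact ⟨fun _ => 0, by simp, by simpa using (Nat.le_zero.1 (by simpa using hTk)).symm⟩
  | succ k ih =>
    rw [Nat.succ_mul] at hTk
    have hmin : Even (min T h) := by rcases min_choice T h with h | h <;> rwa [h]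
    obtain ⟨c, hc, hsum⟩ := ih (T - min T h) (hT.tsub hmin) (by omega)
    refine ⟨update c k (min T h), fun t => ?_, ?_⟩
    · rcases eq_or_ne t k with rfl | ht
      · simpa using hmin
      · simpa [ht] using hc t
    · rw [Finset.sum_range_succ, update_self,
        Finset.sum_congr rfl fun t ht => update_of_ne (Finset.mem_range.1 ht).ne _ _, hsum]
      omega

lemma exists_sum_ne_one {h : ℕ} (hh : 3 ≤ h) (k T : ℕ) (hT : T ≠ 1) (hTk : T ≤ k * h) :
    ∃ c : ℕ → ℕ, (∀ t, c t ≠ 1 ∧ c t ≤ h) ∧ ∑ t ∈ Finset.range k, c t = T := by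
  induction k generalizing T with
  | zero => exact ⟨fun _ => 0, by simp, by simpa using (Nat.le_zero.1 (by simpa using hTk)).symm⟩
  | succ k ih =>
    rw [Nat.succ_mul] at hTk
    obtain ⟨e, he, heh, heT, hTe, hek⟩ :
        ∃ e, e ≠ 1 ∧ e ≤ h ∧ e ≤ T ∧ T - e ≠ 1 ∧ T - e ≤ k * h := by
      rcases Nat.lt_trichotomy T (h + 1) with h1 | h1 | h1
      · exact ⟨T, by omega, by omega, by omega, by omega, by omega⟩
      · have hk : k ≠ 0 := by rintro rfl; omega
        have := Nat.le_mul_of_pos_left h (Nat.pos_of_ne_zero hk)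
        exact ⟨h - 1, by omega, by omega, by omega, by omega, by omega⟩
      · exact ⟨h, by omega, by omega, by omega, by omega, by omega⟩
    obtain ⟨c, hc, hsum⟩ := ih (T - e) hTe hek
    refine ⟨update c k e, fun t => ?_, ?_⟩
    · rcases eq_or_ne t k with rfl | ht
      · simpa using ⟨he, heh⟩
      · simpa [ht] using hc t
    · rw [Finset.sum_range_succ, update_self,
        Finset.sum_congr rfl fun t ht => update_of_ne (Finset.mem_range.1 ht).ne _ _, hsum]
      omega

namespace Packing

lemma mul_sub_two {g h : ℕ} (hg : 1 ≤ g) : 2 * g * h = (2 * g - 2) * h + 2 * h := by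
  rw [← Nat.add_mul]; congr 1; omega

variable {h m g s : ℕ} [NeZero h]

lemma complete_of_block {b : ℕ} (hg : 1 ≤ g)
    (hb : Packing m (fun x y : Bool × ZMod h => x ≠ y) (2 * h - 1) b) (c : ℕ → ℕ)
    (hc : ∀ t, Packing m (fun x y : Bool × ZMod h => x.1 ≠ y.1) h (c t))
    (hs : b + ∑ t ∈ Finset.range (2 * g - 2), c t = s) :
    Packing m (fun x y : Fin (2 * g * h) => x ≠ y) (2 * g * h - 1) s := by
  rw [← hs]
  refine blowUp_complete hg (by rw [ZMod.card]) ?_ c hb fun t _ => hc t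
  obtain ⟨g, rfl⟩ : ∃ k, g = k + 1 := ⟨g - 1, by omega⟩
  have := NeZero.pos h
  rw [show 2 * (g + 1) - 2 = 2 * g by omega, show 2 * (g + 1) * h = 2 * g * h + 2 * h by ring]
  omega

lemma complete_of_even (hg : 1 ≤ g) (hh : Even h) (hs : s ≤ 2 * g * h - 1)
    (hbip : ∀ t, Even t → t ≤ h → Packing m (fun x y : Bool × ZMod h => x.1 ≠ y.1) h t)
    (hb : ∀ b, b % 2 = s % 2 → min s (2 * h - 2) ≤ b → b ≤ 2 * h - 1 →
      Packing m (fun x y : Bool × ZMod h => x ≠ y) (2 * h - 1) b) :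
    Packing m (fun x y : Fin (2 * g * h) => x ≠ y) (2 * g * h - 1) s := by
  have hmul := mul_sub_two (h := h) hg
  have hpos := NeZero.pos h
  obtain ⟨k, hk⟩ := hh
  have heven : (2 * g - 2) * h = 2 * ((2 * g - 2) * k) := by rw [hk]; ring
  obtain ⟨b, T, hbs, hsb, hbh, hT, hTk, hbT⟩ : ∃ b T, b % 2 = s % 2 ∧ min s (2 * h - 2) ≤ b ∧
      b ≤ 2 * h - 1 ∧ T % 2 = 0 ∧ T ≤ (2 * g - 2) * h ∧ b + T = s := by
    by_cases h1 : s ≤ 2 * h - 1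
    · exact ⟨s, 0, by omega⟩
    · exact ⟨2 * h - 2 + s % 2, s - (2 * h - 2 + s % 2), by omega⟩
  obtain ⟨c, hc, hsum⟩ := exists_even_sum ⟨k, hk⟩ (2 * g - 2) T (Nat.even_iff.2 hT) hTk
  exact complete_of_block hg (hb b hbs hsb hbh) c (fun t => hbip _ (hc t).1 (hc t).2)
    (by rw [hsum, hbT])

lemma block_even (hh : 2 ≤ h) (hs : Even s) (hs' : s ≤ 2 * h - 1) :
    Packing (2 * h) (fun x y : Bool × ZMod h => x ≠ y) (2 * h - 1) s := by
  obtain ⟨e, rfl⟩ := hs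
  have : NeZero (2 * h - 1) := ⟨by omega⟩
  have := hamiltonian_even (N := 2 * h - 1) (g := h - 1) (e := e) (by omega) (by omega) (by omega)
  rw [show 2 * h - 1 + 1 = 2 * h by omega, two_mul e] at this
  refine this.complete_congr ?_
  simp only [Fintype.card_option, Fintype.card_prod, Fintype.card_bool, ZMod.card]
  omega

lemma complete_even (hg : 1 ≤ g) (hh : Even h) (hs : Even s) (hs' : s ≤ 2 * g * h - 1) :
    Packing (2 * h) (fun x y : Fin (2 * g * h) => x ≠ y) (2 * g * h - 1) s := by
  have hpos := NeZero.pos h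
  refine complete_of_even hg hh hs'
    (fun t ht hth => bipartite hth (fun h1 => by simp [h1] at ht) fun h1 => absurd ht
      (Nat.not_even_iff_odd.2 h1))
    fun b hb _ hbh => block_even ?_ (Nat.even_iff.2 (by rw [hb, Nat.even_iff.1 hs])) hbh
  obtain ⟨k, hk⟩ := hh
  omega

lemma block_odd (hh : 4 ≤ h) (heven : Even h) (hs : Odd s) (hs5 : 5 ≤ s) (hs' : s ≤ 2 * h - 1) :
    Packing (2 * h) (fun x y : Bool × ZMod h => x ≠ y) (2 * h - 1) s := by
  obtain ⟨n, rfl⟩ := heven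
  rw [show 2 * (n + n) = 4 * n by ring] at *
  obtain rfl | hn : n = 2 ∨ 3 ≤ n := by omega
  · refine (octet_eight ?_).complete_congr (by simp [ZMod.card])
    obtain ⟨k, rfl⟩ := hs
    omega
  · have : NeZero (2 * n - 1) := ⟨by omega⟩
    refine (hamiltonian_odd hn hs hs5 hs').complete_congr ?_
    simp only [Fintype.card_option, Fintype.card_prod, Fintype.card_bool, Fintype.card_fin,
      ZMod.card]
    omega

lemma complete_odd (hg : 1 ≤ g) (hh : 4 ≤ h) (heven : Even h) (hs : Odd s) (hs5 : 5 ≤ s)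
    (hs' : s ≤ 2 * g * h - 1) :
    Packing (2 * h) (fun x y : Fin (2 * g * h) => x ≠ y) (2 * g * h - 1) s := by
  refine complete_of_even hg heven hs'
    (fun t ht hth => bipartite hth (fun h1 => by simp [h1] at ht) fun h1 => absurd ht
      (Nat.not_even_iff_odd.2 h1))
    fun b hb hsb hbh => block_odd hh heven (Nat.odd_iff.2 (by rw [hb, Nat.odd_iff.1 hs])) ?_ hbh
  omega

lemma complete_of_odd_half (hg : Even s ∨ 2 ≤ g) (hg1 : 1 ≤ g) (hh : 3 ≤ h) (hodd : Odd h)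
    (hs1 : s ≠ 1) (hs3 : s ≠ 3) (hs : s ≤ 2 * g * h - 2) :
    Packing (2 * h) (fun x y : Fin (2 * g * h) => x ≠ y) (2 * g * h - 1) s := by
  have hmul := mul_sub_two (h := h) hg1
  obtain ⟨b, T, hb, hbh, hT, hTk, hbT⟩ : ∃ b T, Even b ∧ b ≤ 2 * h - 2 ∧ T ≠ 1 ∧
      T ≤ (2 * g - 2) * h ∧ b + T = s := by
    simp only [Nat.even_iff] at hg ⊢
    by_cases h1 : s % 2 = 0
    · by_cases h2 : s ≤ 2 * h - 2
      · exact ⟨s, 0, by omega⟩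
      · exact ⟨2 * h - 2, s - (2 * h - 2), by omega⟩
    · by_cases h2 : s ≤ 2 * h + 1
      · have := Nat.mul_le_mul (show 1 ≤ 2 * g - 2 by omega) hh
        exact ⟨s - 3, 3, by omega⟩
      · exact ⟨2 * h - 2, s - (2 * h - 2), by omega⟩
  obtain ⟨c, hc, hsum⟩ := exists_sum_ne_one hh (2 * g - 2) T hT hTk
  exact complete_of_block hg1 (block_even (by omega) hb (by omega)) c
    (fun t => bipartite (hc t).2 (hc t).1 fun _ => hodd) (by rw [hsum, hbT])

lemma complete_all (hg : 1 ≤ g) (hh : 5 ≤ h) (hodd : Odd h) :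
    Packing (2 * h) (fun x y : Fin (2 * g * h) => x ≠ y) (2 * g * h - 1) (2 * g * h - 1) := by
  have hmul := mul_sub_two (h := h) hg
  have : NeZero (h - 1) := ⟨by omega⟩
  refine complete_of_block hg ((hamiltonian_all hh (Nat.odd_iff.1 hodd)).complete_congr ?_)
    (fun _ => h) (fun _ => bipartite le_rfl (by omega) fun _ => hodd) ?_
  · simp only [Fintype.card_option, Fintype.card_prod, Fintype.card_bool, Fintype.card_fin,
      ZMod.card]
    omega
  · simp only [Finset.sum_const, Finset.card_range, smul_eq_mul]
    omega

lemma complete_six_all (hg : 1 ≤ g) :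
    Packing 6 (fun x y : Fin (2 * g * 6) => x ≠ y) (2 * g * 6 - 1) (2 * g * 6 - 1) := by
  refine complete_of_block hg (dozen_six.complete_congr (by simp [ZMod.card])) (fun _ => 6)
    (fun _ => bipartite_six_six) ?_
  simp only [Finset.sum_const, Finset.card_range, smul_eq_mul]
  omega

lemma complete_four_eight (hg : 1 ≤ g) (hs : Odd s) (hs1 : s ≠ 1) (hs' : s ≤ 2 * g * 4 - 1) :
    Packing 4 (fun x y : Fin (2 * g * 4) => x ≠ y) (2 * g * 4 - 1) s := by
  rw [Nat.odd_iff] at hs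
  exact complete_of_even hg (by decide) hs' (fun t => bipartite_four) fun b hb hsb hbh =>
    (octet_four (by omega)).complete_congr (by simp [ZMod.card])

lemma complete_four_twelve (hg : 1 ≤ g) (hs : Odd s) (hs7 : 7 ≤ s) (hs' : s ≤ 2 * g * 6 - 1) :
    Packing 4 (fun x y : Fin (2 * g * 6) => x ≠ y) (2 * g * 6 - 1) s := by
  rw [Nat.odd_iff] at hs
  exact complete_of_even hg (by decide) hs' (fun t => bipartite_six_four) fun b hb hsb hbh =>
    (dozen_four (by omega)).complete_congr (by simp [ZMod.card])

end Packing

/-- The directed uniform Hamilton–Waterloo problem `HWP*(v; 2^r, m^s)` for even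
`m ≥ 4` has a solution under the stated divisibility, counting and congruence
conditions. -/
theorem hwp_two_m (v m r s : ℕ) (hm : 4 ≤ m) (hme : Even m)
    (hdvd : m ∣ v) (hrs : r + s = v - 1) (hs1 : s ≠ 1)
    (hrv : ¬(r = 0 ∧ v = 6)) (hmrv : ¬(m = 4 ∧ r = 0 ∧ v = 4))
    (hcond :
      (4 < m ∧ s ≠ 3 ∧ m % 4 = 0) ∨
      (4 < m ∧ Even (v / m) ∧ s ≠ 3 ∧ m % 4 = 2) ∨
      (m = 4 ∧ (v % 24 = 0 ∨ v % 24 = 8 ∨ v % 24 = 16)) ∨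
      (m = 4 ∧ v % 24 = 12 ∧ s ≠ 3 ∧ s ≠ 5) ∨
      (m = 4 ∧ (v % 24 = 4 ∨ v % 24 = 20) ∧ Odd r)) :
    HWPStar v 2 m r s := by
  refine Packing.hwpStar (Fintype.card_fin v) (by omega) hrs ?_
  obtain ⟨h, rfl⟩ := even_iff_two_dvd.1 hme
  obtain ⟨g, rfl⟩ := hdvd
  obtain rfl | hg : g = 0 ∨ 1 ≤ g := by omega
  · obtain rfl : s = 0 := by omega
    exact Packing.empty
  rw [Nat.mul_div_cancel_left _ (by omega : 0 < 2 * h)] at hcond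
  rw [show 2 * h * g = 2 * g * h by ring] at *
  have : NeZero h := ⟨by omega⟩
  have hsv : s ≤ 2 * g * h - 1 := by omega
  rcases Nat.even_or_odd s with hs | hs
  · rcases Nat.even_or_odd h with hh | hh
    · exact Packing.complete_even hg hh hs hsv
    · have := Nat.odd_iff.1 hh
      refine Packing.complete_of_odd_half (Or.inl hs) hg (by omega) hh hs1 ?_ ?_
      · rintro rfl; exact absurd hs (by decide)
      · have := Nat.even_iff.1 hs
        rw [show 2 * g * h = 2 * (g * h) by ring] at hsv ⊢
        omega
  have hs2 := Nat.odd_iff.1 hs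
  rcases hcond with ⟨h4, hs3, hmod⟩ | ⟨h4, hge, hs3, hmod⟩ | ⟨h4, hv⟩ | ⟨h4, hv, hs3, hs5⟩ |
    ⟨h4, hv, hr⟩
  · exact Packing.complete_odd hg (by omega) (Nat.even_iff.2 (by omega)) hs (by omega) hsv
  · have hh : Odd h := Nat.odd_iff.2 (by omega)
    obtain hs' | rfl : s ≤ 2 * g * h - 2 ∨ s = 2 * g * h - 1 := by omega
    · have := Nat.even_iff.1 hge
      exact Packing.complete_of_odd_half (Or.inr (by omega)) hg (by omega) hh hs1 hs3 hs'
    obtain rfl | h5 : h = 3 ∨ 5 ≤ h := by omega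
    · obtain ⟨k, rfl⟩ := hge
      rw [show 2 * (k + k) * 3 = 2 * k * 6 by ring]
      exact Packing.complete_six_all (by omega)
    · exact Packing.complete_all hg h5 hh
  all_goals obtain rfl : h = 2 := by omega
  · obtain ⟨k, rfl⟩ : ∃ k, g = 2 * k := ⟨g / 2, by omega⟩
    rw [show 2 * (2 * k) * 2 = 2 * k * 4 by ring] at *
    exact Packing.complete_four_eight (by omega) hs hs1 hsv
  · obtain ⟨k, rfl⟩ : ∃ k, g = 3 * k := ⟨g / 3, by omega⟩
    rw [show 2 * (3 * k) * 2 = 2 * k * 6 by ring] at *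
    exact Packing.complete_four_twelve (by omega) hs (by omega) hsv
  · have := Nat.odd_iff.1 hr
    omega
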